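/- arXiv:2001.01668 — 5 statements merged into one kernel-verified Lean document; each statement's English description precedes it below -/
import Mathlib

section
/- Theorem 2 (universal composition with Simmons' scheme). Let t ∈ P(Y|X), q ∈ P(Z|X) be channels over finite alphabets and j ≥ 1. If (r, α, κ) ∈ C_{AA(j)}(t,q), then for every nonnegative real β < r, the triple (r − β, α + β, κ + (1 + 1/j)β) also belongs to C_{AA(j)}(t,q). -/
/-!
Secret key authentication capacity region (average authentication metric):
Theorem 2 (universal composition with Simmons' scheme).
-/

open scoped BigOperators

noncomputable section

namespace AuthAvg

/-- `t` is a (row-stochastic) channel from `A` to `B`. -/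
def IsChannel {A B : Type*} [Fintype B] (t : A → B → ℝ) : Prop :=
  (∀ a b, 0 ≤ t a b) ∧ ∀ a, ∑ b, t a b = 1

/-- `τ` is a probability distribution on the finite set `A`. -/
def IsDist {A : Type*} [Fintype A] (τ : A → ℝ) : Prop :=
  (∀ a, 0 ≤ τ a) ∧ ∑ a, τ a = 1

/-- The memoryless `n`-fold extension of a channel:
`t^n(y|x) = ∏ ℓ, t (x ℓ) (y ℓ)`. -/
def nfold {A B : Type*} (t : A → B → ℝ) (n : ℕ) (x : Fin n → A) (y : Fin n → B) : ℝ :=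
  ∏ ℓ, t (x ℓ) (y ℓ)

variable {X Y Z : Type*} [Fintype X] [Fintype Y] [Fintype Z]

/-- Probability of message error of a single round: the message and the key are
uniform, the channel input is generated by the encoder `f`, the output passes
through the (non-attacked) channel `t^n`, and the decoder `φ` must reproduce
the message. -/
def roundError {n M K : ℕ} (t : X → Y → ℝ)
    (f : Fin M × Fin K → (Fin n → X) → ℝ)
    (φ : (Fin n → Y) × Fin K → Option (Fin M) → ℝ) : ℝ :=
  1 - (1 / ((M : ℝ) * (K : ℝ))) *
      ∑ m : Fin M, ∑ k : Fin K, ∑ x : Fin n → X, ∑ y : Fin n → Y,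
        φ (y, k) (some m) * nfold t n x y * f (m, k) x

/-- The joint probability that the adversary observes `z = (z_0, …, z_i)` over the
channel `q^n` in rounds `0, …, i`, that the round-`i` message equals `m`, and
that the key equals `k`. -/
def advDist {n M K j : ℕ} (q : X → Z → ℝ)
    (f : Fin j → Fin M × Fin K → (Fin n → X) → ℝ) (i : Fin j)
    (z : Fin (i.1 + 1) → Fin n → Z) (m : Fin M) (k : Fin K) : ℝ :=
  (1 / ((M : ℝ) ^ (i.1 + 1) * (K : ℝ))) *
    (∑ x : Fin n → X, nfold q n x (z (Fin.last i.1)) * f i (m, k) x) *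
    ∏ ℓ : Fin i.1, ∑ m' : Fin M, ∑ x : Fin n → X,
      nfold q n x (z ℓ.castSucc) * f ⟨ℓ.1, ℓ.2.trans i.2⟩ (m', k) x

/-- The expected probability that the adversary's substitution attack `ψ` in
round `i` makes the decoder output some message different from the one sent. -/
def attackProb {n M K j : ℕ} (q : X → Z → ℝ)
    (f : Fin j → Fin M × Fin K → (Fin n → X) → ℝ)
    (φ : Fin j → (Fin n → Y) × Fin K → Option (Fin M) → ℝ) (i : Fin j)
    (ψ : (Fin (i.1 + 1) → Fin n → Z) → (Fin n → Y) → ℝ) : ℝ :=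
  ∑ z : Fin (i.1 + 1) → Fin n → Z, ∑ m : Fin M, ∑ k : Fin K,
    advDist q f i z m k *
      ∑ y : Fin n → Y, ψ z y * ∑ m' ∈ Finset.univ.erase m, φ i (y, k) (some m')

/-- `(r, α, κ, ε, j, n)`-average-authentication code for the DM-AIC `(t, q)`:
blocklength `n`, message rate at least `r`, key consumption rate at most `κ`,
probability of message error (minimized over the rounds) less than `ε`, and
authentication rate at least `α` (that is, for every round and every attack
channel the expected probability of false authentication is at most
`2^(-n·α)`). -/
def IsAACode (t : X → Y → ℝ) (q : X → Z → ℝ) (r α κ ε : ℝ) (j n : ℕ) : Prop :=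
  ∃ (M K : ℕ) (f : Fin j → Fin M × Fin K → (Fin n → X) → ℝ)
      (φ : Fin j → (Fin n → Y) × Fin K → Option (Fin M) → ℝ),
    0 < M ∧ 0 < K ∧
    (∀ i, IsChannel (f i)) ∧ (∀ i, IsChannel (φ i)) ∧
    (2 : ℝ) ^ ((n : ℝ) * r) ≤ (M : ℝ) ∧
    (K : ℝ) ≤ (2 : ℝ) ^ ((n : ℝ) * (j : ℝ) * κ) ∧
    (∃ i : Fin j, roundError t (f i) (φ i) < ε) ∧
    (∀ (i : Fin j) (ψ : (Fin (i.1 + 1) → Fin n → Z) → (Fin n → Y) → ℝ),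
      IsChannel ψ → attackProb q f φ i ψ ≤ (2 : ℝ) ^ (-(n : ℝ) * α))

/-- Membership of `(a, b, c)` in the average authentication capacity region
`C_{AA(j)}(t, q)`: there is a sequence of `(r_n, α_n, κ_n, ε_n, j, n)`-AA codes
with `(r_n, α_n, κ_n, ε_n) → (a, b, c, 0)`. -/
def InCapRegion (t : X → Y → ℝ) (q : X → Z → ℝ) (j : ℕ) (a b c : ℝ) : Prop :=
  ∃ r α κ ε : ℕ → ℝ,
    (∀ n : ℕ, IsAACode t q (r n) (α n) (κ n) (ε n) j n) ∧
    Filter.Tendsto (fun n => (r n, α n, κ n, ε n)) Filter.atTop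
      (nhds (a, b, c, 0))

lemma sum_inj_le {A B : Type*} [Fintype A] [Fintype B] (ι : A → B)
    (hι : Function.Injective ι) (g : B → ℝ) (hg : ∀ b, 0 ≤ g b) :
    ∑ a, g (ι a) ≤ ∑ b, g b := by
  classical
  rw [← Finset.sum_image (s := Finset.univ) (g := ι) (f := g) (fun a _ b _ h => hι h)]
  exact Finset.sum_le_sum_of_subset_of_nonneg (Finset.subset_univ _) (fun b _ _ => hg b)

lemma sum_pair_le {S F : Type*} [Fintype S] [Fintype F] [AddCommGroup F] {M : ℕ}
    (ι : S × F → Fin M) (hι : Function.Injective ι) (u : S → F)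
    (g : Fin M → ℝ) (hg : ∀ b, 0 ≤ g b) :
    ∑ s, ∑ c, g (ι (s, u s + c)) ≤ ∑ m, g m := by
  have : ∀ s, ∑ c, g (ι (s, u s + c)) = ∑ c, g (ι (s, c)) := fun s =>
    Equiv.sum_comp (Equiv.addLeft (u s)) (fun c => g (ι (s, c)))
  simp_rw [this]
  rw [← Fintype.sum_prod_type (f := fun p => g (ι p))]
  exact sum_inj_le ι hι g hg

lemma sum_keys {F : Type*} [Fintype F] {j : ℕ} (i : Fin j) (H : F → ℝ)
    (G : Fin i.1 → F → ℝ) :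
    ∑ b : Fin j → F, H (b i) * ∏ ℓ : Fin i.1, G ℓ (b ⟨ℓ.1, ℓ.2.trans i.2⟩)
      = (Fintype.card F : ℝ) ^ (j - i.1 - 1) * ((∑ c, H c) * ∏ ℓ, ∑ c, G ℓ c) := by
  classical
  obtain ⟨i, hi⟩ := i
  obtain ⟨m, rfl⟩ : ∃ m, j = (i + 1) + m := ⟨j - (i + 1), by omega⟩
  simp only at G ⊢
  let g : Fin (i + 1 + m) → F → ℝ := fun x c =>
    if h : x.1 < i then G ⟨x.1, h⟩ c else if x.1 = i then H c else 1
  have key : ∀ b : Fin (i + 1 + m) → F, ∏ x, g x (b x)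
      = H (b ⟨i, hi⟩) * ∏ ℓ : Fin i, G ℓ (b ⟨ℓ.1, ℓ.2.trans hi⟩) := by
    intro b
    rw [Fin.prod_univ_add, Fin.prod_univ_castSucc]
    have h3 : ∏ x : Fin m, g (Fin.natAdd (i+1) x) (b (Fin.natAdd (i+1) x)) = 1 := by
      apply Finset.prod_eq_one
      intro x _
      have h1 : ¬ (i + 1 + x.1 < i) := by omega
      have h2 : ¬ (i + 1 + x.1 = i) := by omega
      simp [g, h1, h2]
    rw [h3, mul_one, mul_comm]
    congr 1
    · simp [g]; rfl
    · apply Finset.prod_congr rfl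
      intro x _
      simp [g]; rfl
  have h2 : ∏ x, ∑ c, g x c = (Fintype.card F : ℝ) ^ m * ((∑ c, H c) * ∏ ℓ, ∑ c, G ℓ c) := by
    rw [Fin.prod_univ_add, Fin.prod_univ_castSucc]
    have h3 : ∏ x : Fin m, ∑ c, g (Fin.natAdd (i+1) x) c = (Fintype.card F : ℝ) ^ m := by
      rw [Finset.prod_congr rfl (g := fun _ => (Fintype.card F : ℝ))]
      · simp
      · intro x _
        have h1 : ¬ (i + 1 + x.1 < i) := by omega
        have h2 : ¬ (i + 1 + x.1 = i) := by omega
        simp [g, h1, h2]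
    rw [h3, mul_comm]
    congr 1
    rw [mul_comm]
    congr 1
    · simp [g]
    · apply Finset.prod_congr rfl
      intro x _
      simp [g]
  have : i + 1 + m - i - 1 = m := by omega
  rw [this, ← h2, Finset.prod_univ_sum, Fintype.piFinset_univ]
  exact Finset.sum_congr rfl fun b _ => (key b).symm

lemma hash_attack {F : Type*} [Fintype F] [DecidableEq F] [AddCommGroup F] {M M' d : ℕ}
    (ι : Fin M' × F → Fin M) (hι : Function.Injective ι) (h : F → Fin M' → F)
    (hh : ∀ s s', s ≠ s' → ∀ c, (Finset.univ.filter (fun a => h a s' - h a s = c)).card ≤ d)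
    (W χ : Fin M → ℝ) (hW : ∀ m, 0 ≤ W m) (hχ : ∀ m, 0 ≤ χ m) :
    ∑ s, ∑ a, ∑ c, W (ι (s, h a s + c)) * ∑ s' ∈ Finset.univ.erase s, χ (ι (s', h a s' + c))
      ≤ d * ∑ m, W m * ∑ m' ∈ Finset.univ.erase m, χ m' := by
  have h1 : ∀ s a, ∑ c, W (ι (s, h a s + c)) *
        ∑ s' ∈ Finset.univ.erase s, χ (ι (s', h a s' + c))
      = ∑ c, W (ι (s, c)) * ∑ s' ∈ Finset.univ.erase s, χ (ι (s', (h a s' - h a s) + c)) := by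
    intro s a
    rw [← Equiv.sum_comp (Equiv.addLeft (h a s)) (fun c => W (ι (s, c)) *
      ∑ s' ∈ Finset.univ.erase s, χ (ι (s', (h a s' - h a s) + c)))]
    refine Finset.sum_congr rfl fun c _ => ?_
    simp only [Equiv.coe_addLeft]
    congr 1
    refine Finset.sum_congr rfl fun s' _ => ?_
    congr 3
    abel
  have h2 : ∀ s s' c, s ≠ s' → ∑ a, χ (ι (s', (h a s' - h a s) + c))
      ≤ d * ∑ c', χ (ι (s', c')) := by
    intro s s' c hs
    rw [← Finset.sum_fiberwise (s := Finset.univ) (g := fun a => h a s' - h a s)]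
    rw [← Equiv.sum_comp (Equiv.addRight c) (fun c' => χ (ι (s', c'))), Finset.mul_sum]
    refine Finset.sum_le_sum fun v _ => ?_
    rw [Finset.sum_congr rfl (g := fun _ => χ (ι (s', v + c)))]
    · rw [Finset.sum_const, nsmul_eq_mul]
      exact mul_le_mul_of_nonneg_right (by exact_mod_cast hh s s' hs v) (hχ _)
    · intro a ha
      rw [Finset.mem_filter] at ha
      rw [ha.2]
  have h3 : ∀ s c, ∑ a, ∑ s' ∈ Finset.univ.erase s, χ (ι (s', (h a s' - h a s) + c))
      ≤ d * ∑ m' ∈ Finset.univ.erase (ι (s, c)), χ m' := by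
    intro s c
    rw [Finset.sum_comm]
    calc _ ≤ ∑ s' ∈ Finset.univ.erase s, d * ∑ c', χ (ι (s', c')) :=
          Finset.sum_le_sum fun s' hs' => h2 s s' c (Finset.ne_of_mem_erase hs').symm
      _ = d * ∑ s' ∈ Finset.univ.erase s, ∑ c', χ (ι (s', c')) := by rw [Finset.mul_sum]
      _ ≤ _ := by
        refine mul_le_mul_of_nonneg_left ?_ (Nat.cast_nonneg _)
        rw [← Finset.sum_product (f := fun p => χ (ι p)),
          ← Finset.sum_image (g := ι) (f := χ) (fun a _ b _ h => hι h)]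
        refine Finset.sum_le_sum_of_subset_of_nonneg ?_ (fun m _ _ => hχ m)
        intro m hm
        rw [Finset.mem_image] at hm
        obtain ⟨p, hp, rfl⟩ := hm
        simp only [Finset.mem_product, Finset.mem_erase, Finset.mem_univ, and_true] at hp
        simp only [Finset.mem_erase, Finset.mem_univ, and_true]
        intro he
        exact hp (by rw [hι he])
  calc _ = ∑ s, ∑ c, W (ι (s, c)) *
        ∑ a, ∑ s' ∈ Finset.univ.erase s, χ (ι (s', (h a s' - h a s) + c)) := by
        refine Finset.sum_congr rfl fun s _ => ?_
        simp_rw [h1]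
        rw [Finset.sum_comm]
        simp_rw [Finset.mul_sum]
    _ ≤ ∑ s, ∑ c, W (ι (s, c)) * (d * ∑ m' ∈ Finset.univ.erase (ι (s, c)), χ m') :=
        Finset.sum_le_sum fun s _ => Finset.sum_le_sum fun c _ =>
          mul_le_mul_of_nonneg_left (h3 s c) (hW _)
    _ = d * ∑ p : Fin M' × F, W (ι p) * ∑ m' ∈ Finset.univ.erase (ι p), χ m' := by
        rw [Fintype.sum_prod_type, Finset.mul_sum]
        refine Finset.sum_congr rfl fun s _ => ?_
        rw [Finset.mul_sum]
        refine Finset.sum_congr rfl fun c _ => ?_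
        ring
    _ ≤ _ := by
        refine mul_le_mul_of_nonneg_left ?_ (Nat.cast_nonneg _)
        exact sum_inj_le ι hι (fun m => W m * ∑ m' ∈ Finset.univ.erase m, χ m')
          (fun m => mul_nonneg (hW m) (Finset.sum_nonneg fun m' _ => hχ m'))

/-- composed encoder -/
def compF {F : Type*} [AddCommGroup F] {n M M' K K' j : ℕ}
    (e : Fin K' ≃ Fin K × F × (Fin j → F)) (ι : Fin M' × F → Fin M) (h : F → Fin M' → F)
    (f : Fin j → Fin M × Fin K → (Fin n → X) → ℝ) :
    Fin j → Fin M' × Fin K' → (Fin n → X) → ℝ := fun i p =>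
  f i (ι (p.1, h (e p.2).2.1 p.1 + (e p.2).2.2 i), (e p.2).1)

/-- composed decoder -/
def compPhi {F : Type*} [AddCommGroup F] {n M M' K K' j : ℕ}
    (e : Fin K' ≃ Fin K × F × (Fin j → F)) (ι : Fin M' × F → Fin M) (h : F → Fin M' → F)
    (φ : Fin j → (Fin n → Y) × Fin K → Option (Fin M) → ℝ) :
    Fin j → (Fin n → Y) × Fin K' → Option (Fin M') → ℝ := fun i p o =>
  match o with
  | some s => φ i (p.1, (e p.2).1) (some (ι (s, h (e p.2).2.1 s + (e p.2).2.2 i)))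
  | none => 1 - ∑ s, φ i (p.1, (e p.2).1) (some (ι (s, h (e p.2).2.1 s + (e p.2).2.2 i)))

lemma sum_some_le {A : Type*} {M : ℕ} {φ : A → Option (Fin M) → ℝ} (hφ : IsChannel φ) (a : A) :
    ∑ m, φ a (some m) ≤ 1 := by
  have := hφ.2 a
  rw [Fintype.sum_option] at this
  linarith [hφ.1 a none]

lemma nfold_nonneg {A B : Type*} [Fintype B] {t : A → B → ℝ} (ht : IsChannel t) (n : ℕ)
    (x : Fin n → A) (y : Fin n → B) : 0 ≤ nfold t n x y :=
  Finset.prod_nonneg fun _ _ => ht.1 _ _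

lemma nfold_sum {A B : Type*} [Fintype B] {t : A → B → ℝ} (ht : IsChannel t) (n : ℕ)
    (x : Fin n → A) : ∑ y, nfold t n x y = 1 := by
  classical
  unfold nfold
  have := (Finset.prod_univ_sum (fun _ : Fin n => (Finset.univ : Finset B))
    (fun ℓ b => t (x ℓ) b)).symm
  rw [Fintype.piFinset_univ] at this
  rw [this]
  simp [ht.2]

lemma compPhi_isChannel {F : Type*} [AddCommGroup F] {n M M' K K' j : ℕ}
    (e : Fin K' ≃ Fin K × F × (Fin j → F)) (ι : Fin M' × F → Fin M)
    (hι : Function.Injective ι) (h : F → Fin M' → F)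
    (φ : Fin j → (Fin n → Y) × Fin K → Option (Fin M) → ℝ) (hφ : ∀ i, IsChannel (φ i)) (i : Fin j) :
    IsChannel (compPhi e ι h φ i) := by
  refine ⟨?_, ?_⟩
  · intro p o
    cases o with
    | some s => exact (hφ i).1 _ _
    | none =>
      simp only [compPhi, sub_nonneg]
      refine le_trans (sum_inj_le (fun s => ι (s, h (e p.2).2.1 s + (e p.2).2.2 i)) ?_
        (fun m => φ i (p.1, (e p.2).1) (some m)) (fun m => (hφ i).1 _ _))
        (sum_some_le (hφ i) _)
      intro s s' hs
      exact congrArg Prod.fst (hι hs)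
  · intro p
    rw [Fintype.sum_option]
    simp [compPhi]

/-- error for a given message and key -/
def pointSucc {n M K : ℕ} (t : X → Y → ℝ)
    (f : Fin M × Fin K → (Fin n → X) → ℝ)
    (φ : (Fin n → Y) × Fin K → Option (Fin M) → ℝ) (m : Fin M) (k : Fin K) : ℝ :=
  ∑ x : Fin n → X, ∑ y : Fin n → Y, φ (y, k) (some m) * nfold t n x y * f (m, k) x

lemma pointSucc_le {n M K : ℕ} {t : X → Y → ℝ} (ht : IsChannel t)
    {f : Fin M × Fin K → (Fin n → X) → ℝ} (hf : IsChannel f)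
    {φ : (Fin n → Y) × Fin K → Option (Fin M) → ℝ} (hφ : IsChannel φ) (m : Fin M) (k : Fin K) :
    pointSucc t f φ m k ≤ 1 := by
  unfold pointSucc
  calc _ ≤ ∑ x : Fin n → X, ∑ y : Fin n → Y, nfold t n x y * f (m, k) x := by
        refine Finset.sum_le_sum fun x _ => Finset.sum_le_sum fun y _ => ?_
        rw [mul_assoc]
        refine mul_le_of_le_one_left (mul_nonneg (nfold_nonneg ht _ _ _) (hf.1 _ _)) ?_
        refine le_trans ?_ (sum_some_le hφ (y, k))
        exact Finset.single_le_sum (f := fun m => φ (y, k) (some m)) (fun m _ => hφ.1 _ _)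
          (Finset.mem_univ m)
    _ = 1 := by
        simp_rw [← Finset.sum_mul, nfold_sum ht, one_mul]
        exact hf.2 _

lemma roundError_eq {n M K : ℕ} (hM : 0 < M) (hK : 0 < K) (t : X → Y → ℝ)
    (f : Fin M × Fin K → (Fin n → X) → ℝ)
    (φ : (Fin n → Y) × Fin K → Option (Fin M) → ℝ) :
    roundError t f φ = (1 / ((M : ℝ) * (K : ℝ))) * ∑ m, ∑ k, (1 - pointSucc t f φ m k) := by
  have : (M : ℝ) ≠ 0 := by positivity
  have : (K : ℝ) ≠ 0 := by positivity
  unfold roundError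
  simp only [Finset.sum_sub_distrib, Finset.sum_const, Finset.card_univ, Fintype.card_fin,
    nsmul_eq_mul, mul_one, mul_sub]
  change _ - 1 / ((M : ℝ) * (K : ℝ)) * ∑ m, ∑ k, pointSucc t f φ m k = _
  congr 1
  field_simp

lemma M_bound {n M K : ℕ} (hM : 0 < M) (hK : 0 < K) {t : X → Y → ℝ} (ht : IsChannel t)
    {f : Fin M × Fin K → (Fin n → X) → ℝ} (hf : IsChannel f)
    {φ : (Fin n → Y) × Fin K → Option (Fin M) → ℝ} (hφ : IsChannel φ)
    (herr : roundError t f φ < 1 / 2) : (M : ℝ) ≤ 2 * (Fintype.card Y : ℝ) ^ n := by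
  have hM' : (0:ℝ) < M := by positivity
  have hK' : (0:ℝ) < K := by positivity
  have hle : ∀ x y, nfold t n x y ≤ 1 := fun x y => by
    rw [← nfold_sum ht n x]
    exact Finset.single_le_sum (fun y _ => nfold_nonneg ht n x y) (Finset.mem_univ y)
  have h1 : ∀ k, ∑ m, pointSucc t f φ m k ≤ (Fintype.card Y : ℝ) ^ n := by
    intro k
    have h2 : ∀ m, pointSucc t f φ m k ≤ ∑ y : Fin n → Y, φ (y, k) (some m) := by
      intro m
      unfold pointSucc
      rw [Finset.sum_comm]
      refine Finset.sum_le_sum fun y _ => ?_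
      simp_rw [mul_assoc]
      rw [← Finset.mul_sum]
      refine mul_le_of_le_one_right (hφ.1 _ _) ?_
      rw [← hf.2 (m, k)]
      exact Finset.sum_le_sum fun x _ => mul_le_of_le_one_left (hf.1 _ _) (hle x y)
    calc _ ≤ ∑ m, ∑ y : Fin n → Y, φ (y, k) (some m) := Finset.sum_le_sum fun m _ => h2 m
      _ = ∑ y : Fin n → Y, ∑ m, φ (y, k) (some m) := Finset.sum_comm
      _ ≤ ∑ y : Fin n → Y, 1 := Finset.sum_le_sum fun y _ => sum_some_le hφ _
      _ = _ := by classical simp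
  have h3 : ∑ m, ∑ k, pointSucc t f φ m k ≤ K * (Fintype.card Y : ℝ) ^ n := by
    rw [Finset.sum_comm]
    refine (Finset.sum_le_sum fun k _ => h1 k).trans ?_
    simp
  have h4 : roundError t f φ = 1 - 1 / ((M : ℝ) * K) * ∑ m, ∑ k, pointSucc t f φ m k := rfl
  have h5 : 1 / ((M : ℝ) * K) * ∑ m, ∑ k, pointSucc t f φ m k
      ≤ 1 / ((M : ℝ) * K) * (K * (Fintype.card Y : ℝ) ^ n) :=
    mul_le_mul_of_nonneg_left h3 (by positivity)
  have h6 : 1 / ((M : ℝ) * K) * (K * (Fintype.card Y : ℝ) ^ n) = (Fintype.card Y : ℝ) ^ n / M := by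
    field_simp
  have h7 : 1 / 2 < (Fintype.card Y : ℝ) ^ n / M := by linarith
  rw [lt_div_iff₀ hM'] at h7
  linarith

lemma comp_error {F : Type*} [Fintype F] [AddCommGroup F] {n M M' K K' j : ℕ}
    (hM' : 0 < M') (hM : 0 < M) (hK : 0 < K)
    (e : Fin K' ≃ Fin K × F × (Fin j → F)) (ι : Fin M' × F → Fin M)
    (hι : Function.Injective ι) (h : F → Fin M' → F)
    (hMle : M ≤ 2 * (M' * Fintype.card F))
    {t : X → Y → ℝ} (ht : IsChannel t)
    (f : Fin j → Fin M × Fin K → (Fin n → X) → ℝ) (hf : ∀ i, IsChannel (f i))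
    (φ : Fin j → (Fin n → Y) × Fin K → Option (Fin M) → ℝ) (hφ : ∀ i, IsChannel (φ i))
    (i : Fin j) :
    roundError t (compF e ι h f i) (compPhi e ι h φ i) ≤ 2 * roundError t (f i) (φ i) := by
  have hQ : 0 < Fintype.card F := Fintype.card_pos
  have hK'eq : K' = K * (Fintype.card F * Fintype.card F ^ j) := by
    classical
    have := Fintype.card_congr e
    simpa using this
  have hK' : 0 < K' := by rw [hK'eq]; positivity
  rw [roundError_eq hM' hK', roundError_eq hM hK]
  set g : Fin M → Fin K → ℝ := fun m k => 1 - pointSucc t (f i) (φ i) m k with hg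
  have hg0 : ∀ m k, 0 ≤ g m k := fun m k => sub_nonneg.2 (pointSucc_le ht (hf i) (hφ i) m k)
  have h1 : ∀ s k', 1 - pointSucc t (compF e ι h f i) (compPhi e ι h φ i) s k'
      = g (ι (s, h (e k').2.1 s + (e k').2.2 i)) (e k').1 := fun s k' => rfl
  simp_rw [h1]
  set Q : ℝ := (Fintype.card F : ℝ) with hQd
  have hQp : 0 < Q := by positivity
  have h2 : ∑ s, ∑ k', g (ι (s, h (e k').2.1 s + (e k').2.2 i)) (e k').1
      = Q ^ (j - 1) * ∑ a : F, ∑ k, ∑ s, ∑ c, g (ι (s, h a s + c)) k := by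
    have h3 : ∀ s, ∑ k', g (ι (s, h (e k').2.1 s + (e k').2.2 i)) (e k').1
       = ∑ k, ∑ a, Q ^ (j - 1) * ∑ c, g (ι (s, h a s + c)) k := by
      intro s
      rw [Equiv.sum_comp e (fun p => g (ι (s, h p.2.1 s + p.2.2 i)) p.1), Fintype.sum_prod_type]
      refine Finset.sum_congr rfl fun k _ => ?_
      rw [Fintype.sum_prod_type]
      refine Finset.sum_congr rfl fun a _ => ?_
      have := sum_keys i (fun c => g (ι (s, h a s + c)) k) (fun _ _ => 1)
      simp only [Finset.prod_const_one, mul_one, Finset.sum_const, Finset.card_univ,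
        nsmul_eq_mul, Finset.prod_const, Fintype.card_fin] at this
      rw [this]
      have hj : j - 1 = (j - i.1 - 1) + i.1 := by omega
      rw [hj, pow_add]
      ring
    simp_rw [h3, ← Finset.mul_sum]
    congr 1
    rw [Finset.sum_comm]
    rw [Finset.sum_comm (s := (Finset.univ : Finset F))]
    refine Finset.sum_congr rfl fun k _ => ?_
    rw [Finset.sum_comm]
  rw [h2]
  have h4 : ∑ a : F, ∑ k, ∑ s, ∑ c, g (ι (s, h a s + c)) k ≤ Q * ∑ m, ∑ k, g m k := by
    calc _ ≤ ∑ a : F, ∑ k, ∑ m, g m k := Finset.sum_le_sum fun a _ => Finset.sum_le_sum fun k _ =>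
          sum_pair_le ι hι (h a) (fun m => g m k) (fun m => hg0 m k)
      _ = _ := by
        rw [Finset.sum_const, Finset.card_univ, nsmul_eq_mul, Finset.sum_comm]
  have hS : 0 ≤ ∑ m, ∑ k, g m k := Finset.sum_nonneg fun m _ => Finset.sum_nonneg fun k _ => hg0 m k
  set S := ∑ m, ∑ k, g m k with hSd
  have hMr : (0:ℝ) < M := by positivity
  have hMr' : (0:ℝ) < M' := by positivity
  have hKr : (0:ℝ) < K := by positivity
  have hMler : (M : ℝ) ≤ 2 * (M' * Q) := by rw [hQd]; exact_mod_cast hMle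
  have hjj : Q ^ j = Q ^ (j - 1) * Q := by
    rw [← pow_succ]; congr 1; have := i.2; omega
  have hKr' : (K' : ℝ) = K * (Q * (Q ^ (j - 1) * Q)) := by
    rw [hK'eq, ← hjj]; push_cast; rfl
  calc _ ≤ 1 / ((M' : ℝ) * K') * (Q ^ (j - 1) * (Q * S)) := by gcongr
    _ = S / (K * (M' * Q)) := by rw [hKr']; field_simp
    _ ≤ S / (K * (M / 2)) := by gcongr; linarith
    _ = _ := by field_simp

/-- adversary's observation likelihood in a single round -/
def obs {n M K : ℕ} (q : X → Z → ℝ) (f : Fin M × Fin K → (Fin n → X) → ℝ)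
    (z : Fin n → Z) (m : Fin M) (k : Fin K) : ℝ :=
  ∑ x : Fin n → X, nfold q n x z * f (m, k) x

lemma comp_attack {F : Type*} [Fintype F] [DecidableEq F] [AddCommGroup F]
    {n M M' K K' j d : ℕ}
    (hM' : 0 < M') (hM : 0 < M) (hK : 0 < K)
    (e : Fin K' ≃ Fin K × F × (Fin j → F)) (ι : Fin M' × F → Fin M)
    (hι : Function.Injective ι) (h : F → Fin M' → F)
    (hh : ∀ s s', s ≠ s' → ∀ c, (Finset.univ.filter (fun a => h a s' - h a s = c)).card ≤ d)
    (hMle : M ≤ 2 * (M' * Fintype.card F))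
    {q : X → Z → ℝ} (hq : IsChannel q)
    (f : Fin j → Fin M × Fin K → (Fin n → X) → ℝ) (hf : ∀ i, IsChannel (f i))
    (φ : Fin j → (Fin n → Y) × Fin K → Option (Fin M) → ℝ) (hφ : ∀ i, IsChannel (φ i))
    (i : Fin j) (ψ : (Fin (i.1 + 1) → Fin n → Z) → (Fin n → Y) → ℝ) (hψ : IsChannel ψ) :
    attackProb q (compF e ι h f) (compPhi e ι h φ) i ψ
      ≤ (2 ^ j * d / (Fintype.card F : ℝ)) * attackProb q f φ i ψ := by
  have hQ : 0 < Fintype.card F := Fintype.card_pos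
  have hK'eq : K' = K * (Fintype.card F * Fintype.card F ^ j) := by
    have := Fintype.card_congr e
    simpa using this
  set Q : ℝ := (Fintype.card F : ℝ) with hQd
  have hQp : 0 < Q := by positivity
  let W : (l : Fin j) → (Fin n → Z) → Fin K → Fin M → ℝ := fun l z k m => obs q (f l) z m k
  have hW0 : ∀ l z k m, 0 ≤ W l z k m := fun l z k m =>
    Finset.sum_nonneg fun x _ => mul_nonneg (nfold_nonneg hq _ _ _) ((hf l).1 _ _)
  let χ : (Fin (i.1 + 1) → Fin n → Z) → Fin K → Fin M → ℝ := fun z k m =>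
    ∑ y, ψ z y * φ i (y, k) (some m)
  have hχ0 : ∀ z k m, 0 ≤ χ z k m := fun z k m =>
    Finset.sum_nonneg fun x _ => mul_nonneg (hψ.1 _ _) ((hφ i).1 _ _)
  let P : (Fin (i.1 + 1) → Fin n → Z) → Fin K → ℝ := fun z k =>
    ∏ ℓ : Fin i.1, ∑ m, W ⟨ℓ.1, ℓ.2.trans i.2⟩ (z ℓ.castSucc) k m
  have hP0 : ∀ z k, 0 ≤ P z k := fun z k =>
    Finset.prod_nonneg fun l _ => Finset.sum_nonneg fun m _ => hW0 _ _ _ _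
  let B : (Fin (i.1 + 1) → Fin n → Z) → Fin K → ℝ := fun z k =>
    P z k * ∑ m, W i (z (Fin.last i.1)) k m * ∑ m' ∈ Finset.univ.erase m, χ z k m'
  have hB0 : ∀ z k, 0 ≤ B z k := fun z k => mul_nonneg (hP0 z k) (Finset.sum_nonneg fun m _ =>
    mul_nonneg (hW0 _ _ _ _) (Finset.sum_nonneg fun m' _ => hχ0 _ _ _))
  have hatt : attackProb q f φ i ψ
      = (1 / ((M : ℝ) ^ (i.1 + 1) * (K : ℝ))) * ∑ z, ∑ k, B z k := by
    unfold attackProb advDist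
    rw [Finset.mul_sum]
    refine Finset.sum_congr rfl fun z _ => ?_
    rw [Finset.sum_comm, Finset.mul_sum]
    refine Finset.sum_congr rfl fun k _ => ?_
    simp only [B]
    rw [Finset.mul_sum, Finset.mul_sum]
    refine Finset.sum_congr rfl fun m _ => ?_
    have : ∑ y, ψ z y * ∑ m' ∈ Finset.univ.erase m, φ i (y, k) (some m')
        = ∑ m' ∈ Finset.univ.erase m, χ z k m' := by
      simp only [χ]
      rw [Finset.sum_comm]
      simp_rw [Finset.mul_sum]
    rw [this]
    change 1 / ((M : ℝ) ^ (i.1 + 1) * (K : ℝ)) * W i (z (Fin.last i.1)) k m * P z k * _ = _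
    ring
  let E : (Fin (i.1 + 1) → Fin n → Z) → Fin M' → (Fin K × F × (Fin j → F)) → ℝ := fun z s p =>
    (W i (z (Fin.last i.1)) p.1 (ι (s, h p.2.1 s + p.2.2 i)) *
      ∑ s' ∈ Finset.univ.erase s, χ z p.1 (ι (s', h p.2.1 s' + p.2.2 i))) *
    ∏ ℓ : Fin i.1, ∑ s', W ⟨ℓ.1, ℓ.2.trans i.2⟩ (z ℓ.castSucc) p.1
      (ι (s', h p.2.1 s' + p.2.2 ⟨ℓ.1, ℓ.2.trans i.2⟩))
  have hatt' : attackProb q (compF e ι h f) (compPhi e ι h φ) i ψ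
      = (1 / ((M' : ℝ) ^ (i.1 + 1) * (K' : ℝ))) * ∑ z, ∑ s, ∑ p, E z s p := by
    unfold attackProb advDist
    rw [Finset.mul_sum]
    refine Finset.sum_congr rfl fun z _ => ?_
    rw [Finset.mul_sum]
    refine Finset.sum_congr rfl fun s _ => ?_
    rw [← Equiv.sum_comp e, Finset.mul_sum]
    refine Finset.sum_congr rfl fun k' _ => ?_
    have : ∑ y, ψ z y * ∑ s' ∈ Finset.univ.erase s, compPhi e ι h φ i (y, k') (some s')
        = ∑ s' ∈ Finset.univ.erase s, χ z (e k').1 (ι (s', h (e k').2.1 s' + (e k').2.2 i)) := by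
      simp only [χ]
      rw [Finset.sum_comm]
      simp_rw [Finset.mul_sum]
      rfl
    rw [this]
    simp only [E]
    rw [mul_assoc, mul_assoc]
    congr 1
    rw [mul_assoc, mul_comm (∑ s' ∈ Finset.univ.erase s, _)]
    rfl
  have hmain : ∀ z, ∑ s, ∑ p, E z s p ≤ Q ^ (j - i.1 - 1) * d * ∑ k, B z k := by
    intro z
    simp_rw [Fintype.sum_prod_type]
    rw [Finset.sum_comm, Finset.mul_sum]
    refine Finset.sum_le_sum fun k _ => ?_
    have h1 : ∀ s a, ∑ b, E z s (k, a, b) ≤ (Q ^ (j - i.1 - 1) * P z k) *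
        ∑ c, W i (z (Fin.last i.1)) k (ι (s, h a s + c)) *
          ∑ s' ∈ Finset.univ.erase s, χ z k (ι (s', h a s' + c)) := by
      intro s a
      simp only [E]
      rw [sum_keys i (fun c => W i (z (Fin.last i.1)) k (ι (s, h a s + c)) *
          ∑ s' ∈ Finset.univ.erase s, χ z k (ι (s', h a s' + c)))
        (fun ℓ c => ∑ s', W ⟨ℓ.1, ℓ.2.trans i.2⟩ (z ℓ.castSucc) k (ι (s', h a s' + c)))]
      rw [mul_assoc, mul_comm (P z k)]
      refine mul_le_mul_of_nonneg_left ?_ (by positivity)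
      refine mul_le_mul_of_nonneg_left ?_ (Finset.sum_nonneg fun c _ =>
        mul_nonneg (hW0 _ _ _ _) (Finset.sum_nonneg fun m' _ => hχ0 _ _ _))
      refine Finset.prod_le_prod (fun l _ => Finset.sum_nonneg fun c _ =>
        Finset.sum_nonneg fun s' _ => hW0 _ _ _ _) fun l _ => ?_
      rw [Finset.sum_comm]
      exact sum_pair_le ι hι (h a) _ (hW0 _ _ _)
    calc _ ≤ ∑ s, ∑ a, (Q ^ (j - i.1 - 1) * P z k) *
        ∑ c, W i (z (Fin.last i.1)) k (ι (s, h a s + c)) *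
          ∑ s' ∈ Finset.univ.erase s, χ z k (ι (s', h a s' + c)) :=
          Finset.sum_le_sum fun s _ => Finset.sum_le_sum fun a _ => h1 s a
      _ = (Q ^ (j - i.1 - 1) * P z k) * ∑ s, ∑ a,
        ∑ c, W i (z (Fin.last i.1)) k (ι (s, h a s + c)) *
          ∑ s' ∈ Finset.univ.erase s, χ z k (ι (s', h a s' + c)) := by
          simp_rw [Finset.mul_sum]
      _ ≤ (Q ^ (j - i.1 - 1) * P z k) * (d * ∑ m, W i (z (Fin.last i.1)) k m *
            ∑ m' ∈ Finset.univ.erase m, χ z k m') := by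
          refine mul_le_mul_of_nonneg_left ?_ (mul_nonneg (by positivity) (hP0 z k))
          exact hash_attack ι hι h hh _ _ (hW0 _ _ _) (hχ0 _ _)
      _ = _ := by simp only [B]; ring
  have hS : 0 ≤ ∑ z, ∑ k, B z k := Finset.sum_nonneg fun z _ => Finset.sum_nonneg fun k _ => hB0 z k
  have hsum : ∑ z, ∑ s, ∑ p, E z s p ≤ Q ^ (j - i.1 - 1) * d * ∑ z, ∑ k, B z k := by
    rw [Finset.mul_sum]
    exact Finset.sum_le_sum fun z _ => hmain z
  rw [hatt, hatt']
  set S := ∑ z, ∑ k, B z k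
  have hMr : (0:ℝ) < M := by positivity
  have hMr' : (0:ℝ) < M' := by positivity
  have hKr : (0:ℝ) < K := by positivity
  have hMler : (M : ℝ) ≤ 2 * (M' * Q) := by rw [hQd]; exact_mod_cast hMle
  have hjj : Q ^ j = Q ^ (j - i.1 - 1) * Q ^ (i.1 + 1) := by
    rw [← pow_add]; congr 1; have := i.2; omega
  have hKr' : (K' : ℝ) = K * (Q * (Q ^ (j - i.1 - 1) * Q ^ (i.1 + 1))) := by
    rw [hK'eq, ← hjj]; push_cast; rfl
  have hpow : (M : ℝ) ^ (i.1 + 1) ≤ 2 ^ j * (M' * Q) ^ (i.1 + 1) := by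
    calc (M : ℝ) ^ (i.1 + 1) ≤ (2 * (M' * Q)) ^ (i.1 + 1) := by gcongr
      _ = 2 ^ (i.1 + 1) * (M' * Q) ^ (i.1 + 1) := by rw [mul_pow]
      _ ≤ _ := by
        gcongr
        · norm_num
        · exact i.2
  calc _ ≤ 1 / ((M' : ℝ) ^ (i.1 + 1) * K') * (Q ^ (j - i.1 - 1) * d * S) := by gcongr
    _ = (d * S / (Q * K)) * (1 / (M' * Q) ^ (i.1 + 1)) := by rw [hKr', mul_pow]; field_simp
    _ ≤ (d * S / (Q * K)) * (2 ^ j / M ^ (i.1 + 1)) := by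
        refine mul_le_mul_of_nonneg_left ?_ (by positivity)
        rw [div_le_div_iff₀ (by positivity) (by positivity)]
        linarith
    _ = _ := by field_simp

lemma exists_hash {F : Type*} [Field F] [Fintype F] [DecidableEq F] (N d : ℕ)
    (hN : N ≤ Fintype.card F ^ d) :
    ∃ h : F → Fin N → F, ∀ s s', s ≠ s' → ∀ c,
      (Finset.univ.filter (fun a => h a s' - h a s = c)).card ≤ d := by
  classical
  obtain ⟨g⟩ : Nonempty (Fin N ↪ (Fin d → F)) := by
    apply Function.Embedding.nonempty_of_card_le
    simpa using hN
  refine ⟨fun a s => ∑ l : Fin d, g s l * a ^ (l.1 + 1), ?_⟩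
  intro s s' hs c
  let p : Polynomial F := (∑ l : Fin d, Polynomial.C (g s' l - g s l) * Polynomial.X ^ (l.1 + 1))
    - Polynomial.C c
  have hdeg : p.natDegree ≤ d := by
    refine (Polynomial.natDegree_sub_le _ _).trans ?_
    refine max_le ?_ (by simp)
    refine Polynomial.natDegree_sum_le_of_forall_le _ _ fun l _ => ?_
    exact (Polynomial.natDegree_C_mul_X_pow_le _ _).trans l.2
  have hp : p ≠ 0 := by
    have hne : g s' ≠ g s := fun he => hs (g.injective he).symm
    obtain ⟨l, hl⟩ := Function.ne_iff.1 hne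
    intro h0
    have hc : p.coeff (l.1 + 1) = g s' l - g s l := by
      simp only [p, Polynomial.coeff_sub, Polynomial.finsetSum_coeff,
        Polynomial.coeff_C_mul_X_pow, Polynomial.coeff_C_succ, sub_zero]
      rw [Finset.sum_eq_single l]
      · simp
      · intro b _ hb
        rw [if_neg]
        intro hlb
        exact hb (Fin.ext (by omega))
      · simp
    rw [h0, Polynomial.coeff_zero] at hc
    exact hl (sub_eq_zero.1 hc.symm)
  calc _ ≤ p.roots.toFinset.card := by
        apply Finset.card_le_card
        intro a ha
        rw [Finset.mem_filter] at ha
        rw [Multiset.mem_toFinset, Polynomial.mem_roots hp, Polynomial.IsRoot.def]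
        simp only [p, Polynomial.eval_sub, Polynomial.eval_finsetSum, Polynomial.eval_mul,
          Polynomial.eval_C, Polynomial.eval_pow, Polynomial.eval_X]
        rw [← ha.2]
        simp only [sub_mul, Finset.sum_sub_distrib, sub_self]
    _ ≤ p.roots.card := Multiset.toFinset_card_le _
    _ ≤ p.natDegree := Polynomial.card_roots' _
    _ ≤ d := hdeg

/-- One-shot composition. -/
lemma compose_code {t : X → Y → ℝ} {q : X → Z → ℝ} (ht : IsChannel t) (hq : IsChannel q)
    {r α κ ε β : ℝ} {j n d D : ℕ} (hj : 1 ≤ j) (hβ : 0 < β) (hn : 1 ≤ (n : ℝ) * β / 2)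
    (hβr : β < r) (hε : ε < 1 / 2)
    (hd : (2 * (Fintype.card Y + 1) : ℝ) ≤ (2 : ℝ) ^ (β / 2 * d)) (hD : d * 2 ^ (j + 1) ≤ 2 ^ D)
    (hc : IsAACode t q r α κ ε j n) :
    IsAACode t q (r - β - 1 / n) (α + β - D / n) (κ + (1 + 1 / (j : ℝ)) * β) (2 * ε) j n := by
  classical
  obtain ⟨M, K, f, φ, hM, hK, hf, hφ, hMr, hKr, ⟨i₀, hi₀⟩, hatt⟩ := hc
  have hn0 : (0:ℝ) < n := by
    by_contra hcon
    have : (n : ℝ) = 0 := le_antisymm (not_lt.1 hcon) (Nat.cast_nonneg _)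
    rw [this] at hn
    norm_num at hn
  have hn1 : 1 ≤ n := by exact_mod_cast hn0
  set w : ℕ := ⌊(n : ℝ) * β⌋₊ with hw
  have hw1 : (w : ℝ) ≤ n * β := Nat.floor_le (by positivity)
  have hw2 : (n : ℝ) * β < w + 1 := Nat.lt_floor_add_one _
  have hw0 : w ≠ 0 := by
    intro h0
    rw [h0] at hw2
    norm_num at hw2
    linarith
  haveI : Fact (Nat.Prime 2) := ⟨Nat.prime_two⟩
  let F := GaloisField 2 w
  haveI : Fintype F := Fintype.ofFinite F
  have hcard : Fintype.card F = 2 ^ w := by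
    rw [← Nat.card_eq_fintype_card]; exact GaloisField.card 2 w hw0
  set Q := Fintype.card F with hQ
  have hQr : (Q : ℝ) = (2:ℝ) ^ (w : ℝ) := by rw [hcard]; simp
  have hQle : (Q : ℝ) ≤ (2:ℝ) ^ ((n:ℝ) * β) := by
    rw [hQr]; exact Real.rpow_le_rpow_of_exponent_le (by norm_num) hw1
  have hQge : (2:ℝ) ^ ((n:ℝ) * β - 1) ≤ Q := by
    rw [hQr]; exact Real.rpow_le_rpow_of_exponent_le (by norm_num) (by linarith)
  have hQpos : 0 < Q := Fintype.card_pos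
  have hQposr : (0:ℝ) < Q := by exact_mod_cast hQpos
  have hQM : Q ≤ M := by
    have : (Q : ℝ) ≤ M := hQle.trans ((Real.rpow_le_rpow_of_exponent_le (by norm_num)
      (mul_le_mul_of_nonneg_left hβr.le hn0.le)).trans hMr)
    exact_mod_cast this
  set M' := M / Q with hM'd
  have hM' : 0 < M' := Nat.div_pos hQM hQpos
  have hMQ : M' * Q ≤ M := Nat.div_mul_le_self _ _
  have hMlt : M < M' * Q + Q := by
    have := Nat.lt_div_mul_add (a := M) hQpos
    exact this
  have hMle : M ≤ 2 * (M' * Q) := by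
    have : Q ≤ M' * Q := Nat.le_mul_of_pos_left _ hM'
    omega
  obtain ⟨ι⟩ : Nonempty ((Fin M' × F) ↪ Fin M) := by
    apply Function.Embedding.nonempty_of_card_le
    simpa using hMQ
  have hMB : (M : ℝ) ≤ (Q : ℝ) ^ d := by
    have h1 := M_bound hM hK ht (hf i₀) (hφ i₀) (hi₀.trans hε)
    calc (M : ℝ) ≤ 2 * (Fintype.card Y : ℝ) ^ n := h1
      _ ≤ 2 ^ n * (Fintype.card Y + 1 : ℝ) ^ n := by
        gcongr
        · exact le_self_pow₀ (by norm_num) (by omega)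
        · linarith
      _ = (2 * (Fintype.card Y + 1) : ℝ) ^ n := by rw [mul_pow]
      _ ≤ ((2 : ℝ) ^ (β / 2 * d)) ^ n := by gcongr
      _ = (2:ℝ) ^ (n * β / 2 * d) := by
        rw [← Real.rpow_natCast, ← Real.rpow_mul (by norm_num)]; congr 1; ring
      _ ≤ (2:ℝ) ^ ((n * β - 1) * d) := by
        apply Real.rpow_le_rpow_of_exponent_le (by norm_num)
        apply mul_le_mul_of_nonneg_right _ (Nat.cast_nonneg _)
        linarith
      _ = ((2:ℝ) ^ (n * β - 1)) ^ d := by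
        rw [Real.rpow_mul (by norm_num), Real.rpow_natCast]
      _ ≤ _ := by gcongr
  have hN : M' ≤ Q ^ d := by
    have h1 : M ≤ Q ^ d := by exact_mod_cast hMB
    exact (Nat.div_le_self _ _).trans h1
  obtain ⟨h, hh⟩ := exists_hash (F := F) M' d hN
  set K' := K * (Q * Q ^ j) with hK'
  let e : Fin K' ≃ Fin K × F × (Fin j → F) :=
    Fintype.equivOfCardEq (by simp [hK', hQ])
  refine ⟨M', K', compF e ι h f, compPhi e ι h φ, hM', by positivity, ?_, ?_, ?_, ?_, ⟨i₀, ?_⟩, ?_⟩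
  · intro i
    exact ⟨fun p x => (hf i).1 _ _, fun p => (hf i).2 _⟩
  · exact compPhi_isChannel e ι ι.injective h φ hφ
  · have hexp : (n : ℝ) * (r - β - 1 / n) = n * r - n * β - 1 := by field_simp
    rw [hexp, Real.rpow_sub (by norm_num), Real.rpow_sub (by norm_num), Real.rpow_one,
      div_div, div_le_iff₀ (by positivity)]
    have h1 : (M : ℝ) ≤ 2 * (M' * Q) := by exact_mod_cast hMle
    have h2 : (M' : ℝ) * Q ≤ M' * (2:ℝ) ^ ((n:ℝ) * β) :=
      mul_le_mul_of_nonneg_left hQle (Nat.cast_nonneg _)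
    linarith
  · have hj0 : (j : ℝ) ≠ 0 := by
      have : j ≠ 0 := by omega
      exact_mod_cast this
    have hexp : (n : ℝ) * j * (κ + (1 + 1 / (j : ℝ)) * β)
        = n * j * κ + (n * β + n * β * j) := by field_simp; ring
    rw [hexp, Real.rpow_add (by norm_num), Real.rpow_add (by norm_num),
      Real.rpow_mul (by norm_num) ((n:ℝ) * β), Real.rpow_natCast, hK']
    push_cast
    gcongr
  · have := comp_error hM' hM hK e ι ι.injective h hMle ht f hf φ hφ i₀
    linarith
  · intro i ψ hψ
    have h1 := comp_attack hM' hM hK e ι ι.injective h hh hMle hq f hf φ hφ i ψ hψ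
    have h2 := hatt i ψ hψ
    have hexp : -(n : ℝ) * (α + β - D / n) = D + (-(n * β)) + -n * α := by field_simp; ring
    rw [hexp, Real.rpow_add (by norm_num), Real.rpow_add (by norm_num), Real.rpow_natCast]
    refine h1.trans ?_
    have h3 : (2 ^ j * d / (Q : ℝ)) ≤ 2 ^ D * (2:ℝ) ^ (-((n:ℝ) * β)) := by
      rw [div_le_iff₀ hQposr]
      have h4 : (2:ℝ) ^ (-((n:ℝ) * β)) * (2:ℝ) ^ ((n:ℝ) * β - 1) = 1 / 2 := by
        rw [← Real.rpow_add (by norm_num)]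
        have : -((n:ℝ) * β) + (n * β - 1) = -1 := by ring
        rw [this, Real.rpow_neg_one]; norm_num
      have h5 : (1:ℝ) / 2 ≤ (2:ℝ) ^ (-((n:ℝ) * β)) * Q := by
        rw [← h4]; gcongr
      have h6 : (d : ℝ) * 2 ^ (j + 1) ≤ 2 ^ D := by exact_mod_cast hD
      rw [pow_succ] at h6
      have h7 : (2:ℝ) ^ D * (1 / 2) ≤ 2 ^ D * ((2:ℝ) ^ (-((n:ℝ) * β)) * Q) := by gcongr
      rw [mul_assoc]
      linarith
    exact mul_le_mul h3 h2 (by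
      unfold attackProb advDist
      refine Finset.sum_nonneg fun z _ => Finset.sum_nonneg fun m _ => Finset.sum_nonneg fun k _ => ?_
      refine mul_nonneg (mul_nonneg (mul_nonneg (by positivity) ?_) ?_) ?_
      · exact Finset.sum_nonneg fun x _ => mul_nonneg (nfold_nonneg hq _ _ _) ((hf i).1 _ _)
      · exact Finset.prod_nonneg fun l _ => Finset.sum_nonneg fun m' _ =>
          Finset.sum_nonneg fun x _ => mul_nonneg (nfold_nonneg hq _ _ _) ((hf _).1 _ _)
      · exact Finset.sum_nonneg fun y _ => mul_nonneg (hψ.1 _ _)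
          (Finset.sum_nonneg fun m' _ => (hφ i).1 _ _)) (by positivity)

/-- **Theorem 2** (universal composition with Simmons' scheme).  If
`(r, α, κ) ∈ C_{AA(j)}(t, q)` then for every nonnegative `β < r` also
`(r − β, α + β, κ + (1 + 1/j)β) ∈ C_{AA(j)}(t, q)`. -/
theorem simmons_composition
    (t : X → Y → ℝ) (q : X → Z → ℝ) (ht : IsChannel t) (hq : IsChannel q)
    (j : ℕ) (hj : 1 ≤ j)
    (r α κ : ℝ) (hr : 0 ≤ r) (hα : 0 ≤ α) (hκ : 0 ≤ κ)
    (hmem : InCapRegion t q j r α κ)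
    (β : ℝ) (hβ : 0 ≤ β) (hβr : β < r) :
    InCapRegion t q j (r - β) (α + β) (κ + (1 + 1 / (j : ℝ)) * β) := by
  rcases hβ.eq_or_lt with rfl | hβ
  · simpa using hmem
  classical
  obtain ⟨R, A, Ka, ε, hcode, hlim⟩ := hmem
  have hR : Filter.Tendsto R Filter.atTop (nhds r) := (Prod.tendsto_iff _ _).1 hlim |>.1
  have hlim2 := (Prod.tendsto_iff _ _).1 hlim |>.2
  have hA : Filter.Tendsto A Filter.atTop (nhds α) := (Prod.tendsto_iff _ _).1 hlim2 |>.1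
  have hlim3 := (Prod.tendsto_iff _ _).1 hlim2 |>.2
  have hKa : Filter.Tendsto Ka Filter.atTop (nhds κ) := (Prod.tendsto_iff _ _).1 hlim3 |>.1
  have hE : Filter.Tendsto ε Filter.atTop (nhds 0) := (Prod.tendsto_iff _ _).1 hlim3 |>.2
  have hb1 : 1 < (2:ℝ) ^ (β / 2) := Real.one_lt_rpow (by norm_num) (by positivity)
  obtain ⟨d, hd⟩ := pow_unbounded_of_one_lt (2 * (Fintype.card Y + 1) : ℝ) hb1
  have hd' : (2 * (Fintype.card Y + 1) : ℝ) ≤ (2 : ℝ) ^ (β / 2 * d) := by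
    rw [Real.rpow_mul (by norm_num), Real.rpow_natCast]; exact hd.le
  obtain ⟨D, hD⟩ := pow_unbounded_of_one_lt (d * 2 ^ (j + 1)) (one_lt_two (α := ℕ))
  let good : ℕ → Prop := fun n => 1 ≤ (n : ℝ) * β / 2 ∧ β < R n ∧ ε n < 1 / 2
  have hgood : ∀ᶠ n in Filter.atTop, good n := by
    have h1 : ∀ᶠ n : ℕ in Filter.atTop, 1 ≤ (n : ℝ) * β / 2 := by
      obtain ⟨N, hN⟩ := exists_nat_ge (2 / β)
      filter_upwards [Filter.eventually_ge_atTop N] with n hn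
      have : 2 / β ≤ n := hN.trans (by exact_mod_cast hn)
      rw [div_le_iff₀ hβ] at this
      linarith
    filter_upwards [h1, hR.eventually_const_lt hβr,
      hE.eventually_lt_const (by norm_num : (0:ℝ) < 1 / 2)] with n a b c
    exact ⟨a, b, c⟩
  refine ⟨fun n => if good n then R n - β - 1 / n else R n,
    fun n => if good n then A n + β - D / n else A n,
    fun n => if good n then Ka n + (1 + 1 / (j : ℝ)) * β else Ka n,
    fun n => if good n then 2 * ε n else ε n, ?_, ?_⟩
  · intro n
    by_cases hg : good n
    · simp only [if_pos hg]
      exact compose_code ht hq hj hβ hg.1 hg.2.1 hg.2.2 hd' hD.le (hcode n)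
    · simp only [if_neg hg]
      exact hcode n
  · have hinv : Filter.Tendsto (fun n : ℕ => 1 / (n : ℝ)) Filter.atTop (nhds 0) :=
      tendsto_one_div_atTop_nhds_zero_nat
    have hDn : Filter.Tendsto (fun n : ℕ => (D : ℝ) / (n : ℝ)) Filter.atTop (nhds 0) :=
      tendsto_const_div_atTop_nhds_zero_nat _
    refine Filter.Tendsto.prodMk_nhds ?_ (Filter.Tendsto.prodMk_nhds ?_
      (Filter.Tendsto.prodMk_nhds ?_ ?_))
    · have := (hR.sub_const β).sub hinv
      rw [sub_zero] at this
      refine this.congr' ?_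
      filter_upwards [hgood] with n hg
      rw [if_pos hg]
    · have := (hA.add_const β).sub hDn
      rw [sub_zero] at this
      refine this.congr' ?_
      filter_upwards [hgood] with n hg
      rw [if_pos hg]
    · refine (hKa.add_const ((1 + 1 / (j : ℝ)) * β)).congr' ?_
      filter_upwards [hgood] with n hg
      rw [if_pos hg]
    · have := hE.const_mul 2
      rw [mul_zero] at this
      refine this.congr' ?_
      filter_upwards [hgood] with n hg
      rw [if_pos hg]

end AuthAvg
end
end

section
/- Lemma 1 (chaining of type-class memberships). Let Z, U, W be finite alphabets, n ≥ 1, and let ν ∈ P(Z|U) and σ ∈ P(U ≫ W) be conditional distributions. For sequences z ∈ Z^n, u ∈ U^n, w ∈ W^n: if z ∈ T_ν(u) and u ∈ T_σ(w), then z ∈ T_{νσ}(w), where νσ(c|a) := Σ_b ν(c|b)σ(b|a). -/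
open scoped BigOperators

noncomputable section

namespace Types

/-- `t` is a (row-stochastic) channel from `A` to `B`. -/
def IsChannel {A B : Type*} [Fintype B] (t : A → B → ℝ) : Prop :=
  (∀ a b, 0 ≤ t a b) ∧ ∀ a, ∑ b, t a b = 1

/-- `σ ∈ P(U ≫ W)`: for every `u` there is at most one `w` with `σ(u|w) > 0`. -/
def Deterministic {U W : Type*} (σ : W → U → ℝ) : Prop :=
  ∀ u w w', 0 < σ w u → 0 < σ w' u → w = w'

/-- The number of indices at which the sequence `x` takes the value `a`. -/
def cnt {X : Type*} [DecidableEq X] {n : ℕ} (x : Fin n → X) (a : X) : ℕ :=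
  (Finset.univ.filter fun i => x i = a).card

/-- The number of indices at which `x` takes the value `a` and `y` the value `b`. -/
def cnt2 {X Y : Type*} [DecidableEq X] [DecidableEq Y] {n : ℕ}
    (x : Fin n → X) (y : Fin n → Y) (a : X) (b : Y) : ℕ :=
  (Finset.univ.filter fun i => x i = a ∧ y i = b).card

/-- The empirical distribution `p_x` of the sequence `x`. -/
def empDist {X : Type*} [DecidableEq X] {n : ℕ} (x : Fin n → X) : X → ℝ :=
  fun a => (cnt x a : ℝ) / (n : ℝ)

/-- The conditional empirical distribution `p_{y|x}` (junk value `0` where the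
conditioning count vanishes). -/
def condEmp {X Y : Type*} [DecidableEq X] [DecidableEq Y] {n : ℕ}
    (x : Fin n → X) (y : Fin n → Y) : X → Y → ℝ :=
  fun a b => (cnt2 x y a b : ℝ) / (cnt x a : ℝ)

/-- `y ∈ T_ν(x)`: the conditional empirical distribution of `y` given `x` is
`ν`, expressed by counts: `#{i : x i = a, y i = b} = #{i : x i = a}·ν(b|a)`
for all `a, b`. -/
def InTypeClass {X Y : Type*} [DecidableEq X] [DecidableEq Y] {n : ℕ}
    (ν : X → Y → ℝ) (x : Fin n → X) (y : Fin n → Y) : Prop :=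
  ∀ a b, (cnt2 x y a b : ℝ) = (cnt x a : ℝ) * ν a b

/-- **Lemma 1** (chaining of type-class memberships).  If `z ∈ T_ν(u)` and
`u ∈ T_σ(w)` with `σ ∈ P(U ≫ W)`, then `z ∈ T_{νσ}(w)`, where
`νσ(c|a) = ∑ b, ν(c|b)σ(b|a)`. -/
theorem typeClass_chain {Z U W : Type*}
    [Fintype Z] [Fintype U] [Fintype W]
    [DecidableEq Z] [DecidableEq U] [DecidableEq W]
    {n : ℕ} (hn : 1 ≤ n)
    (ν : U → Z → ℝ) (σ : W → U → ℝ)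
    (hν : IsChannel ν) (hσ : IsChannel σ) (hσ' : Deterministic σ)
    (z : Fin n → Z) (u : Fin n → U) (w : Fin n → W)
    (hz : InTypeClass ν u z) (hu : InTypeClass σ w u) :
    InTypeClass (fun a c => ∑ b, σ a b * ν b c) w z := by
  have hpos : ∀ i, 0 < σ (w i) (u i) := by
    intro i
    have h := hu (w i) (u i)
    have hc : 0 < cnt2 w u (w i) (u i) := by
      unfold cnt2
      exact Finset.card_pos.mpr ⟨i, by simp⟩
    have hc' : (0 : ℝ) < (cnt2 w u (w i) (u i) : ℝ) := by exact_mod_cast hc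
    rcases (hσ.1 (w i) (u i)).lt_or_eq with h1 | h1
    · exact h1
    · rw [← h1, mul_zero] at h
      linarith
  intro a c
  have hsum : cnt2 w z a c
      = ∑ b, (Finset.univ.filter fun i => (w i = a ∧ z i = c) ∧ u i = b).card := by
    unfold cnt2
    rw [Finset.card_eq_sum_card_fiberwise (f := u) (t := Finset.univ) (by simp)]
    simp only [Finset.filter_filter]
  rw [hsum]
  push_cast
  simp only [Finset.mul_sum]
  refine Finset.sum_congr rfl fun b _ => ?_
  rcases (hσ.1 a b).lt_or_eq with h1 | h1
  · have hw : ∀ i, u i = b → w i = a := by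
      intro i hi
      have := hpos i
      rw [hi] at this
      exact hσ' b _ _ this h1
    have e1 : (Finset.univ.filter fun i => (w i = a ∧ z i = c) ∧ u i = b).card
        = cnt2 u z b c := by
      unfold cnt2
      congr 1
      ext i
      have := hw i
      simp only [Finset.mem_filter, Finset.mem_univ, true_and]
      tauto
    have e2 : cnt2 w u a b = cnt u b := by
      unfold cnt2 cnt
      congr 1
      ext i
      have := hw i
      simp only [Finset.mem_filter, Finset.mem_univ, true_and]
      tauto
    rw [e1, hz b c, ← e2, hu a b, mul_assoc]
  · rw [← h1, zero_mul, mul_zero]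
    have : (Finset.univ.filter fun i => (w i = a ∧ z i = c) ∧ u i = b) = ∅ := by
      rw [Finset.filter_eq_empty_iff]
      rintro i - ⟨⟨hw, -⟩, hb⟩
      have := hpos i
      rw [hw, hb, ← h1] at this
      exact lt_irrefl _ this
    rw [this]
    simp

end Types
end
end

section
/- Lemma 3 (typicality probability for a uniformly chosen type-class element). Let Y, U, W be finite alphabets. There exists a constant C > 0, depending only on |Y|, |U|, |W|, such that for every n ≥ 2, every σ ∈ P_n(U ≫ W), τ ∈ P_n(W), μ ∈ P_n(Y|U; στ), every w ∈ T_τ and every y ∈ T_{μσ}(w): if U is a random sequence distributed uniformly on T_σ(w), then Pr(y ∈ T_μ(U)) > 0 and | −(1/n)·log₂ Pr( y ∈ T_μ(U) ) − I(μ, σ|τ) | ≤ C·(log₂ n)/n. -/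
open scoped BigOperators

noncomputable section

namespace Types

open Classical in
/-- The type class `T_ν(x)` as a finite set. -/
def typeFinset {X Y : Type*} [DecidableEq X] [DecidableEq Y] [Fintype Y] {n : ℕ}
    (ν : X → Y → ℝ) (x : Fin n → X) : Finset (Fin n → Y) :=
  Finset.univ.filter fun y => InTypeClass ν x y

/-- Composition of a channel `μ : U → Y` with an input channel `σ : W → U`:
`(μσ)(y|w) = ∑ u, σ(u|w) μ(y|u)`. -/
def comp {U W Y : Type*} [Fintype U] (μ : U → Y → ℝ) (σ : W → U → ℝ) :
    W → Y → ℝ :=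
  fun w y => ∑ u, σ w u * μ u y

/-- Output distribution of `σ : W → U` under the input distribution `τ`. -/
def marg {U W : Type*} [Fintype W] (σ : W → U → ℝ) (τ : W → ℝ) : U → ℝ :=
  fun u => ∑ w, τ w * σ w u

/-- Conditional mutual information `I(μ, σ | τ)` (base-2). -/
def condMutInfo {U W Y : Type*} [Fintype U] [Fintype W] [Fintype Y]
    (μ : U → Y → ℝ) (σ : W → U → ℝ) (τ : W → ℝ) : ℝ :=
  ∑ w, ∑ u, ∑ y, τ w * σ w u * μ u y * Real.logb 2 (μ u y / comp μ σ w y)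

/-- `τ ∈ P_n(A)`: a probability distribution whose masses are multiples of `1/n`. -/
def IsTypeDist {A : Type*} [Fintype A] (n : ℕ) (τ : A → ℝ) : Prop :=
  ((∀ a, 0 ≤ τ a) ∧ ∑ a, τ a = 1) ∧ ∀ a, ∃ m : ℕ, τ a = (m : ℝ) / (n : ℝ)

/-- `ρ ∈ P_n(B|A; π)`: a channel with `ρ(b|a)·n·π(a) ∈ ℕ` for all `a, b`. -/
def IsCondType {A B : Type*} [Fintype A] [Fintype B] (n : ℕ)
    (π : A → ℝ) (ρ : A → B → ℝ) : Prop :=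
  IsChannel ρ ∧ ∀ a b, ∃ m : ℕ, ρ a b * ((n : ℝ) * π a) = (m : ℝ)


section Helpers

variable {X V : Type*} [DecidableEq X] [DecidableEq V] {n : ℕ}

lemma stirling_bd (m : ℕ) :
    (m + 1 : ℝ) * Real.log (m + 1) - (m + 1) ≤ Real.log ((m + 1).factorial : ℝ) ∧
    Real.log ((m + 1).factorial : ℝ) ≤
      (m + 1 : ℝ) * Real.log (m + 1) - (m + 1) + Real.log (m + 1) + 1 := by
  induction m with
  | zero => simp
  | succ m ih =>
    have hf : Real.log ((m + 1 + 1).factorial : ℝ)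
        = Real.log (m + 2) + Real.log ((m + 1).factorial : ℝ) := by
      rw [Nat.factorial_succ (m + 1)]
      push_cast
      rw [Real.log_mul (by positivity) (by positivity)]
      ring_nf
    have h0 : (0 : ℝ) < m + 1 := by positivity
    have h1 : (0 : ℝ) < m + 2 := by positivity
    have a1 : Real.log ((m + 2 : ℝ) / (m + 1)) ≤ (m + 2 : ℝ) / (m + 1) - 1 :=
      Real.log_le_sub_one_of_pos (by positivity)
    have a2 : Real.log ((m + 1 : ℝ) / (m + 2)) ≤ (m + 1 : ℝ) / (m + 2) - 1 :=
      Real.log_le_sub_one_of_pos (by positivity)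
    rw [Real.log_div h1.ne' h0.ne'] at a1
    rw [Real.log_div h0.ne' h1.ne'] at a2
    have b1 : (m + 1 : ℝ) * (Real.log (m + 2) - Real.log (m + 1)) ≤ 1 := by
      calc _ ≤ (m + 1 : ℝ) * ((m + 2 : ℝ) / (m + 1) - 1) := by gcongr
        _ = 1 := by field_simp; ring
    have b2 : (m + 2 : ℝ) * (Real.log (m + 1) - Real.log (m + 2)) ≤ -1 := by
      calc _ ≤ (m + 2 : ℝ) * ((m + 1 : ℝ) / (m + 2) - 1) := by gcongr
        _ = -1 := by field_simp; ring
    have e : ((m + 1 : ℕ) : ℝ) + 1 = m + 2 := by push_cast; ring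
    rw [hf, e]
    constructor
    · nlinarith [ih.1]
    · nlinarith [ih.2]

lemma stirling_abs (n m : ℕ) (hn : 2 ≤ n) (hm : m ≤ n) :
    |Real.log (m.factorial : ℝ) - ((m : ℝ) * Real.log m - m)| ≤ Real.log n + 1 := by
  have hlog : 0 ≤ Real.log (n : ℝ) := Real.log_natCast_nonneg n
  cases m with
  | zero => simp; linarith
  | succ m =>
    have h := stirling_bd m
    have : Real.log ((m : ℝ) + 1) ≤ Real.log n := by
      apply Real.log_le_log (by positivity)
      exact_mod_cast hm
    have h' : 0 ≤ Real.log ((m : ℝ) + 1) := by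
      have := Real.log_natCast_nonneg (m + 1)
      push_cast at this
      exact this
    push_cast
    rw [abs_le]
    constructor <;> linarith [h.1, h.2]

lemma stirling_sum {ι : Type*} [Fintype ι] (n : ℕ) (hn : 2 ≤ n) (f : ι → ℕ) (hf : ∀ i, f i ≤ n) :
    |∑ i, Real.log ((f i).factorial : ℝ) - ∑ i, ((f i : ℝ) * Real.log (f i) - f i)|
      ≤ Fintype.card ι * (Real.log n + 1) := by
  rw [← Finset.sum_sub_distrib]
  refine (Finset.abs_sum_le_sum_abs _ _).trans ?_
  calc _ ≤ ∑ _i : ι, (Real.log n + 1) := Finset.sum_le_sum fun i _ => stirling_abs n _ hn (hf i)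
    _ = _ := by rw [Finset.sum_const, Finset.card_univ, nsmul_eq_mul]

lemma cnt_le (x : Fin n → X) (a : X) : cnt x a ≤ n := by
  unfold cnt
  refine (Finset.card_le_univ _).trans ?_
  simp

lemma cnt2_le (x : Fin n → X) (u : Fin n → V) (a : X) (b : V) : cnt2 x u a b ≤ n := by
  unfold cnt2
  refine (Finset.card_le_univ _).trans ?_
  simp

lemma cnt_pair (x : Fin n → X) (u : Fin n → V) (a : X) (b : V) :
    cnt (fun i => (x i, u i)) (a, b) = cnt2 x u a b := by
  simp [cnt, cnt2]

lemma cnt_eq_card (x : Fin n → X) (a : X) : Fintype.card {i // x i = a} = cnt x a := by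
  rw [Fintype.card_subtype]; rfl

lemma sum_cnt2_right [Fintype V] (x : Fin n → X) (u : Fin n → V) (a : X) :
    ∑ b, cnt2 x u a b = cnt x a := by
  unfold cnt2 cnt
  simp only [Finset.card_filter]
  rw [Finset.sum_comm]
  refine Finset.sum_congr rfl fun i _ => ?_
  by_cases h : x i = a <;> simp [h]

lemma cnt2_comm (x : Fin n → X) (u : Fin n → V) (a : X) (b : V) :
    cnt2 x u a b = cnt2 u x b a := by
  unfold cnt2
  simp only [and_comm]

lemma exists_perm (z z' : Fin n → X) (h : ∀ a, cnt z a = cnt z' a) :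
    ∃ g : Equiv.Perm (Fin n), z ∘ g = z' := by
  have e : ∀ c, Nonempty ({i // z' i = c} ≃ {i // z i = c}) := fun c => by
    rw [← Fintype.card_eq, cnt_eq_card, cnt_eq_card, h]
  replace e := fun c => (e c).some
  refine ⟨Equiv.ofFiberEquiv e, ?_⟩
  funext i
  exact Equiv.ofFiberEquiv_map e i

lemma exists_seq [Fintype X] [Fintype V] (x : Fin n → X) (k : X → V → ℕ)
    (h : ∀ a, ∑ b, k a b = cnt x a) :
    ∃ u : Fin n → V, ∀ a b, cnt2 x u a b = k a b := by
  let B := Σ ab : X × V, Fin (k ab.1 ab.2)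
  have e : ∀ c, Nonempty ({i // x i = c} ≃ {s : B // s.1.1 = c}) := fun c => by
    rw [← Fintype.card_eq, cnt_eq_card, ← h, Fintype.card_subtype, Finset.card_filter]
    rw [Fintype.sum_sigma, Fintype.sum_prod_type]
    have : ∀ (a : X) (b : V), (∑ _i : Fin (k a b), if a = c then 1 else 0)
        = if a = c then k a b else 0 := by
      intro a b
      by_cases h : a = c <;> simp [h]
    simp only [this]
    rw [Finset.sum_comm]
    simp
  replace e := fun c => (e c).some
  let E := Equiv.ofFiberEquiv e
  have hE : ∀ i, (E i).1.1 = x i := Equiv.ofFiberEquiv_map e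
  refine ⟨fun i => (E i).1.2, fun a b => ?_⟩
  have : cnt2 x (fun i => (E i).1.2) a b
      = (Finset.univ.filter fun s : B => s.1 = (a, b)).card := by
    unfold cnt2
    refine Finset.card_equiv E fun i => ?_
    simp only [Finset.mem_filter, Finset.mem_univ, true_and, ← hE, Prod.ext_iff]
  rw [this, Finset.card_filter, Fintype.sum_sigma, Finset.sum_eq_single (a, b)]
  · simp
  · intro ab _ hab
    simp [hab]
  · simp

lemma stab_card [Fintype X] (z : Fin n → X) :
    (Finset.univ.filter fun g : Equiv.Perm (Fin n) => z ∘ g = z).card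
      = ∏ a, (cnt z a).factorial := by
  rw [← Fintype.card_subtype, DomMulAct.stabilizer_card]
  simp only [cnt_eq_card]

lemma cnt2_perm (x : Fin n → X) (u : Fin n → V) (g : Equiv.Perm (Fin n)) (a : X) (b : V) :
    cnt2 (x ∘ g) (u ∘ g) a b = cnt2 x u a b := by
  unfold cnt2
  refine Finset.card_equiv g fun i => ?_
  simp

lemma count_mul [Fintype X] [Fintype V] (x : Fin n → X) (u0 : Fin n → V) :
    ∏ a, (cnt x a).factorial =
    (Finset.univ.filter fun u : Fin n → V => ∀ a b, cnt2 x u a b = cnt2 x u0 a b).card *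
      ∏ ab : X × V, (cnt2 x u0 ab.1 ab.2).factorial := by
  rw [← stab_card]
  have hmaps : ∀ g ∈ (Finset.univ.filter fun g : Equiv.Perm (Fin n) => x ∘ g = x),
      u0 ∘ g ∈ (Finset.univ.filter
        fun u : Fin n → V => ∀ a b, cnt2 x u a b = cnt2 x u0 a b) := by
    intro g hg
    simp only [Finset.mem_filter, Finset.mem_univ, true_and] at hg ⊢
    intro a b
    have := cnt2_perm x u0 g a b
    rwa [hg] at this
  rw [Finset.card_eq_sum_card_fiberwise hmaps]
  rw [Finset.sum_const_nat (m := ∏ ab : X × V, (cnt2 x u0 ab.1 ab.2).factorial)]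
  intro u hu
  simp only [Finset.mem_filter, Finset.mem_univ, true_and] at hu
  obtain ⟨g0, hg0⟩ := exists_perm (fun i => (x i, u0 i)) (fun i => (x i, u i)) (by
    rintro ⟨a, b⟩
    rw [cnt_pair, cnt_pair, hu])
  have h := stab_card (fun i => (x i, u0 i))
  have h2 : ∏ ab : X × V, (cnt2 x u0 ab.1 ab.2).factorial
      = ∏ ab : X × V, (cnt (fun i => (x i, u0 i)) ab).factorial :=
    Finset.prod_congr rfl fun ab _ => by rw [← cnt_pair]
  rw [h2, ← h, Finset.filter_filter]
  symm
  refine Finset.card_equiv (Equiv.mulRight g0) fun g => ?_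
  have k1 : ∀ i, x (g0 i) = x i ∧ u0 (g0 i) = u i := fun i => by
    simpa using congrFun hg0 i
  simp only [Finset.mem_filter, Finset.mem_univ, true_and, Equiv.coe_mulRight, funext_iff,
    Function.comp_apply, Prod.ext_iff, Equiv.Perm.coe_mul]
  rw [← forall_and]
  rw [← g0.forall_congr_right (q := fun i => x (g i) = x i ∧ u0 (g i) = u0 i)]
  simp only [k1]

lemma count_log [Fintype X] [Fintype V] (x : Fin n → X) (u0 : Fin n → V) :
    Real.log ((Finset.univ.filter
      fun u : Fin n → V => ∀ a b, cnt2 x u a b = cnt2 x u0 a b).card : ℝ) =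
      ∑ a, Real.log ((cnt x a).factorial : ℝ)
      - ∑ ab : X × V, Real.log ((cnt2 x u0 ab.1 ab.2).factorial : ℝ) := by
  have h := congrArg (fun m : ℕ => Real.log (m : ℝ)) (count_mul x u0)
  have hpos : ((Finset.univ.filter
      fun u : Fin n → V => ∀ a b, cnt2 x u a b = cnt2 x u0 a b).card : ℝ) ≠ 0 := by
    have : 0 < (Finset.univ.filter
      fun u : Fin n → V => ∀ a b, cnt2 x u a b = cnt2 x u0 a b).card :=
      Finset.card_pos.2 ⟨u0, by simp⟩
    positivity
  simp only [Nat.cast_mul, Nat.cast_prod] at h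
  rw [Real.log_mul hpos (Finset.prod_ne_zero_iff.2 fun _ _ => by positivity),
    Real.log_prod (fun _ _ => by positivity), Real.log_prod (fun _ _ => by positivity)] at h
  linarith

end Helpers

section Main

variable {Y U W : Type*} [Fintype Y] [Fintype U] [Fintype W]
    [DecidableEq Y] [DecidableEq U] [DecidableEq W] {n : ℕ}

lemma sum_triple_y (w : Fin n → W) (y : Fin n → Y) (u : Fin n → U) (a : W) (b : U) :
    ∑ c, cnt2 (fun i => (w i, y i)) u (a, c) b = cnt2 w u a b := by
  unfold cnt2
  simp only [Finset.card_filter]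
  rw [Finset.sum_comm]
  refine Finset.sum_congr rfl fun i _ => ?_
  by_cases h : w i = a <;> by_cases h' : u i = b <;> simp [h, h']

lemma sum_triple_w (w : Fin n → W) (y : Fin n → Y) (u : Fin n → U) (c : Y) (b : U) :
    ∑ a, cnt2 (fun i => (w i, y i)) u (a, c) b = cnt2 u y b c := by
  unfold cnt2
  simp only [Finset.card_filter]
  rw [Finset.sum_comm]
  refine Finset.sum_congr rfl fun i _ => ?_
  by_cases h : y i = c <;> by_cases h' : u i = b <;> simp [h, h']

/-- Joint characterization. -/
lemma joint_iff (σ : W → U → ℝ) (μ : U → Y → ℝ) (hσ : ∀ a b, 0 ≤ σ a b)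
    (hμ : ∀ b, ∑ c, μ b c = 1) (hd : Deterministic σ)
    (w : Fin n → W) (y : Fin n → Y) (u : Fin n → U) :
    (InTypeClass σ w u ∧ InTypeClass μ u y) ↔
      ∀ a c b, (cnt2 (fun i => (w i, y i)) u (a, c) b : ℝ) = cnt w a * σ a b * μ b c := by
  have cu : ∀ b, (cnt u b : ℝ) = ∑ a, (cnt2 w u a b : ℝ) := fun b => by
    rw [← sum_cnt2_right u w b]
    push_cast
    exact Finset.sum_congr rfl fun a _ => by rw [cnt2_comm]
  constructor
  · rintro ⟨h1, h2⟩
    have z : ∀ a c b, σ a b = 0 → cnt2 (fun i => (w i, y i)) u (a, c) b = 0 := by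
      intro a c b h
      have h3 := h1 a b
      rw [h, mul_zero] at h3
      have h4 : cnt2 w u a b = 0 := by exact_mod_cast h3
      rw [← sum_triple_y w y u a b] at h4
      exact (Finset.sum_eq_zero_iff.1 h4) c (Finset.mem_univ c)
    intro a c b
    rcases (hσ a b).eq_or_lt with h | h
    · rw [z a c b h.symm, ← h]; simp
    · have z' : ∀ a', a' ≠ a → σ a' b = 0 := by
        intro a' ha
        by_contra hne
        exact ha (hd b a' a (lt_of_le_of_ne (hσ a' b) (Ne.symm hne)) h)
      have h3 := h2 b c
      rw [cu, Finset.sum_eq_single a, h1 a b, ← sum_triple_w w y u c b,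
        Finset.sum_eq_single a] at h3
      · exact h3
      · intro a' _ ha
        exact z a' c b (z' a' ha)
      · simp
      · intro a' _ ha
        rw [h1, z' a' ha, mul_zero]
      · simp
  · intro h
    have h1 : InTypeClass σ w u := by
      intro a b
      rw [← sum_triple_y w y u a b]
      push_cast
      simp only [h, ← Finset.mul_sum, hμ, mul_one]
    refine ⟨h1, ?_⟩
    intro b c
    rw [← sum_triple_w w y u c b, cu, Finset.sum_mul]
    push_cast
    refine Finset.sum_congr rfl fun a _ => ?_
    rw [h, h1]

lemma info_identity (σ : W → U → ℝ) (μ : U → Y → ℝ) (τ N : W → ℝ) (n : ℕ)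
    (hN : ∀ a, N a = n * τ a) (hN0 : ∀ a, 0 ≤ N a)
    (hσ : ∀ a b, 0 ≤ σ a b) (hσ1 : ∀ a, ∑ b, σ a b = 1)
    (hμ0 : ∀ b c, 0 ≤ μ b c)
    (hμ : ∀ b, ∑ c, μ b c = 1) :
    (∑ a, (N a * Real.log (N a) - N a))
      - (∑ ab : W × U, (N ab.1 * σ ab.1 ab.2 * Real.log (N ab.1 * σ ab.1 ab.2)
          - N ab.1 * σ ab.1 ab.2))
      - ((∑ ac : W × Y, (N ac.1 * comp μ σ ac.1 ac.2 * Real.log (N ac.1 * comp μ σ ac.1 ac.2)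
          - N ac.1 * comp μ σ ac.1 ac.2))
      - (∑ acb : (W × Y) × U,
          (N acb.1.1 * σ acb.1.1 acb.2 * μ acb.2 acb.1.2
            * Real.log (N acb.1.1 * σ acb.1.1 acb.2 * μ acb.2 acb.1.2)
          - N acb.1.1 * σ acb.1.1 acb.2 * μ acb.2 acb.1.2)))
      = n * Real.log 2 * condMutInfo μ σ τ := by
  have s2 : ∀ a b (r : ℝ), N a * σ a b * r = ∑ c, N a * σ a b * μ b c * r := by
    intro a b r
    rw [← Finset.sum_mul, ← Finset.mul_sum, hμ, mul_one]
  have s1 : ∀ a (r : ℝ), N a * r = ∑ b, ∑ c, N a * σ a b * μ b c * r := by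
    intro a r
    simp only [← s2]
    rw [← Finset.sum_mul, ← Finset.mul_sum, hσ1, mul_one]
  have s3 : ∀ a c (r : ℝ), N a * comp μ σ a c * r = ∑ b, N a * σ a b * μ b c * r := by
    intro a c r
    unfold comp
    rw [Finset.mul_sum, Finset.sum_mul]
    simp only [mul_assoc]
  have e1 : ∑ a, (N a * Real.log (N a) - N a)
      = ∑ a, ∑ b, ∑ c, N a * σ a b * μ b c * (Real.log (N a) - 1) := by
    refine Finset.sum_congr rfl fun a _ => ?_
    rw [← s1]; ring
  have e2 : (∑ ab : W × U, (N ab.1 * σ ab.1 ab.2 * Real.log (N ab.1 * σ ab.1 ab.2)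
          - N ab.1 * σ ab.1 ab.2))
      = ∑ a, ∑ b, ∑ c, N a * σ a b * μ b c * (Real.log (N a * σ a b) - 1) := by
    rw [Fintype.sum_prod_type]
    refine Finset.sum_congr rfl fun a _ => Finset.sum_congr rfl fun b _ => ?_
    rw [← s2]; ring
  have e3 : (∑ ac : W × Y, (N ac.1 * comp μ σ ac.1 ac.2 * Real.log (N ac.1 * comp μ σ ac.1 ac.2)
          - N ac.1 * comp μ σ ac.1 ac.2))
      = ∑ a, ∑ b, ∑ c, N a * σ a b * μ b c * (Real.log (N a * comp μ σ a c) - 1) := by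
    rw [Fintype.sum_prod_type]
    refine Finset.sum_congr rfl fun a _ => ?_
    rw [Finset.sum_comm (s := (Finset.univ : Finset U))]
    refine Finset.sum_congr rfl fun c _ => ?_
    rw [← s3]; ring
  have e4 : (∑ acb : (W × Y) × U,
          (N acb.1.1 * σ acb.1.1 acb.2 * μ acb.2 acb.1.2
            * Real.log (N acb.1.1 * σ acb.1.1 acb.2 * μ acb.2 acb.1.2)
          - N acb.1.1 * σ acb.1.1 acb.2 * μ acb.2 acb.1.2))
      = ∑ a, ∑ b, ∑ c, N a * σ a b * μ b c * (Real.log (N a * σ a b * μ b c) - 1) := by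
    rw [Fintype.sum_prod_type, Fintype.sum_prod_type]
    refine Finset.sum_congr rfl fun a _ => ?_
    rw [Finset.sum_comm]
    refine Finset.sum_congr rfl fun b _ => Finset.sum_congr rfl fun c _ => ?_
    ring
  rw [e1, e2, e3, e4]
  unfold condMutInfo
  simp only [Finset.mul_sum, ← Finset.sum_sub_distrib]
  refine Finset.sum_congr rfl fun a _ => Finset.sum_congr rfl fun b _ =>
    Finset.sum_congr rfl fun c _ => ?_
  have hl2 : Real.log 2 ≠ 0 := (Real.log_pos (by norm_num)).ne'
  have hlogb : Real.logb 2 (μ b c / comp μ σ a c) * Real.log 2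
      = Real.log (μ b c / comp μ σ a c) := by
    unfold Real.logb; field_simp
  have R : (n : ℝ) * Real.log 2 * (τ a * σ a b * μ b c * Real.logb 2 (μ b c / comp μ σ a c))
      = N a * σ a b * μ b c * Real.log (μ b c / comp μ σ a c) := by
    rw [← hlogb, hN]; ring
  rw [R]
  by_cases hz : N a * σ a b * μ b c = 0
  · simp [hz]
  · have z1 : N a ≠ 0 := fun h => hz (by simp [h])
    have z2 : σ a b ≠ 0 := fun h => hz (by simp [h])
    have z3 : μ b c ≠ 0 := fun h => hz (by simp [h])
    have z4 : comp μ σ a c ≠ 0 := by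
      have p : 0 < σ a b * μ b c :=
        mul_pos (lt_of_le_of_ne (hσ a b) z2.symm) (lt_of_le_of_ne (hμ0 b c) z3.symm)
      have : σ a b * μ b c ≤ comp μ σ a c :=
        Finset.single_le_sum (f := fun b => σ a b * μ b c)
          (fun b _ => mul_nonneg (hσ a b) (hμ0 b c)) (Finset.mem_univ b)
      linarith
    rw [Real.log_mul (mul_ne_zero z1 z2) z3, Real.log_mul z1 z2, Real.log_mul z1 z4,
      Real.log_div z3 z4]
    ring

end Main


open Classical in
/-- **Lemma 3** (typicality probability for a uniformly chosen type-class
element).  If `U` is uniform on `T_σ(w)`, `w ∈ T_τ` and `y ∈ T_{μσ}(w)`, then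
`Pr(y ∈ T_μ(U)) > 0` and `−n⁻¹·log₂ Pr(y ∈ T_μ(U))` equals `I(μ,σ|τ)` up to
`C·(log₂ n)/n`, with `C` depending only on the alphabet sizes. -/
theorem typicality_probability {Y U W : Type*}
    [Fintype Y] [Fintype U] [Fintype W]
    [DecidableEq Y] [DecidableEq U] [DecidableEq W] :
    ∃ C : ℝ, 0 < C ∧
      ∀ n : ℕ, 2 ≤ n →
      ∀ (τ : W → ℝ) (σ : W → U → ℝ) (μ : U → Y → ℝ),
        IsTypeDist n τ → IsCondType n τ σ → Deterministic σ →
        IsCondType n (marg σ τ) μ →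
      ∀ w : Fin n → W, empDist w = τ →
      ∀ y : Fin n → Y, InTypeClass (comp μ σ) w y →
        0 < ((((typeFinset σ w).filter fun u => InTypeClass μ u y).card : ℝ) /
              ((typeFinset σ w).card : ℝ)) ∧
        |(-(1 / (n : ℝ)) * Real.logb 2
              ((((typeFinset σ w).filter fun u => InTypeClass μ u y).card : ℝ) /
                ((typeFinset σ w).card : ℝ)))
            - condMutInfo μ σ τ|
          ≤ C * Real.logb 2 n / n := by
  set D : ℝ := Fintype.card W + Fintype.card (W × U)
    + (Fintype.card (W × Y) + Fintype.card ((W × Y) × U)) with hD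
  have hD0 : 0 ≤ D := by positivity
  refine ⟨3 * D + 1, by positivity, ?_⟩
  intro n hn τ σ μ hτ hσ hd hμ w hw y hy
  obtain ⟨⟨hσ0, hσ1⟩, hσn⟩ := hσ
  obtain ⟨⟨hμ0, hμ1⟩, hμn⟩ := hμ
  have hn0 : (0 : ℝ) < n := by positivity
  have hN : ∀ a, (cnt w a : ℝ) = n * τ a := fun a => by
    rw [← hw]; unfold empDist; field_simp
  -- integrality of the joint counts
  have hK : ∀ a c b, ∃ m : ℕ, (m : ℝ) = cnt w a * σ a b * μ b c := by
    intro a c b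
    rcases (hσ0 a b).eq_or_lt with h | h
    · exact ⟨0, by simp [← h]⟩
    · obtain ⟨m, hm⟩ := hμn b c
      refine ⟨m, ?_⟩
      have : marg σ τ b = τ a * σ a b := by
        unfold marg
        refine Finset.sum_eq_single a (fun a' _ ha => ?_) (by simp)
        have : σ a' b = 0 := by
          by_contra hne
          exact ha (hd b a' a (lt_of_le_of_ne (hσ0 a' b) (Ne.symm hne)) h)
        rw [this, mul_zero]
      rw [← hm, this, hN]; ring
  choose K hK using hK
  obtain ⟨u0, hu0⟩ := exists_seq (fun i => (w i, y i)) (fun ac b => K ac.1 ac.2 b) (by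
    rintro ⟨a, c⟩
    have h := hy a c
    rw [cnt_pair]
    have : ((∑ b, K a c b : ℕ) : ℝ) = (cnt2 w y a c : ℝ) := by
      rw [h]
      unfold comp
      push_cast
      simp only [hK, Finset.mul_sum, mul_assoc]
    exact_mod_cast this)
  have hu0' : ∀ a c b,
      (cnt2 (fun i => (w i, y i)) u0 (a, c) b : ℝ) = cnt w a * σ a b * μ b c := by
    intro a c b
    rw [hu0, hK]
  have hJ := (joint_iff σ μ hσ0 hμ1 hd w y u0).2 hu0'
  have eA : (typeFinset σ w).filter (fun u => InTypeClass μ u y)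
      = Finset.univ.filter fun u : Fin n → U => ∀ ac b,
        cnt2 (fun i => (w i, y i)) u ac b = cnt2 (fun i => (w i, y i)) u0 ac b := by
    ext u
    simp only [typeFinset, Finset.mem_filter, Finset.mem_univ, true_and]
    rw [joint_iff σ μ hσ0 hμ1 hd w y u]
    constructor
    · rintro h ⟨a, c⟩ b
      have := (h a c b).trans (hu0' a c b).symm
      exact_mod_cast this
    · intro h a c b
      rw [h, hu0']
  have eT : typeFinset σ w
      = Finset.univ.filter fun u : Fin n → U => ∀ a b, cnt2 w u a b = cnt2 w u0 a b := by
    ext u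
    simp only [typeFinset, Finset.mem_filter, Finset.mem_univ, true_and]
    constructor
    · intro h a b
      have := (h a b).trans (hJ.1 a b).symm
      exact_mod_cast this
    · intro h a b
      rw [h, hJ.1]
  have lA := count_log (fun i => (w i, y i)) u0
  have lT := count_log w u0
  rw [← eA] at lA
  rw [← eT] at lT
  have mA : u0 ∈ (typeFinset σ w).filter (fun u => InTypeClass μ u y) := by
    simp [typeFinset, hJ.1, hJ.2]
  have pA : (0 : ℝ) < ((typeFinset σ w).filter (fun u => InTypeClass μ u y)).card := by
    exact_mod_cast Finset.card_pos.2 ⟨u0, mA⟩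
  have pT : (0 : ℝ) < (typeFinset σ w).card := by
    exact_mod_cast Finset.card_pos.2 ⟨u0, (Finset.mem_filter.1 mA).1⟩
  refine ⟨div_pos pA pT, ?_⟩
  have b1 := stirling_sum n hn (fun a => cnt w a) (cnt_le w)
  have b2 := stirling_sum n hn (fun ab : W × U => cnt2 w u0 ab.1 ab.2)
    (fun _ => cnt2_le _ _ _ _)
  have b3 := stirling_sum n hn (fun ac : W × Y => cnt (fun i => (w i, y i)) ac)
    (fun _ => cnt_le _ _)
  have b4 := stirling_sum n hn
    (fun acb : (W × Y) × U => cnt2 (fun i => (w i, y i)) u0 acb.1 acb.2)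
    (fun _ => cnt2_le _ _ _ _)
  have id := info_identity σ μ τ (fun a => (cnt w a : ℝ)) n hN (fun a => by positivity)
    hσ0 hσ1 hμ0 hμ1
  have c2 : ∀ ab : W × U, (cnt w ab.1 : ℝ) * σ ab.1 ab.2 = cnt2 w u0 ab.1 ab.2 :=
    fun ab => (hJ.1 _ _).symm
  have c3 : ∀ ac : W × Y, (cnt w ac.1 : ℝ) * comp μ σ ac.1 ac.2
      = cnt (fun i => (w i, y i)) ac := fun ac => by
    rw [← hy, ← cnt_pair]
  have c4 : ∀ acb : (W × Y) × U, (cnt w acb.1.1 : ℝ) * σ acb.1.1 acb.2 * μ acb.2 acb.1.2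
      = cnt2 (fun i => (w i, y i)) u0 acb.1 acb.2 := fun acb => by
    rw [← hu0']
  simp only [c4] at id
  simp only [c3] at id
  simp only [c2] at id
  have hl2 : 0 < Real.log 2 := Real.log_pos (by norm_num)
  have hl2' : 1 / 2 < Real.log 2 := by linarith [Real.log_two_gt_d9]
  have hln : Real.log 2 ≤ Real.log n := Real.log_le_log (by norm_num) (by exact_mod_cast hn)
  have key : |-Real.log ((((typeFinset σ w).filter fun u => InTypeClass μ u y).card : ℝ) /
      ((typeFinset σ w).card : ℝ)) - n * Real.log 2 * condMutInfo μ σ τ|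
      ≤ D * (Real.log n + 1) := by
    rw [Real.log_div pA.ne' pT.ne', lA, lT, ← id, hD]
    rw [abs_le] at b1 b2 b3 b4 ⊢
    constructor <;> linarith [b1.1, b1.2, b2.1, b2.2, b3.1, b3.2, b4.1, b4.2]
  have key2 : D * (Real.log n + 1) ≤ (3 * D + 1) * Real.log n := by nlinarith
  have rw1 : ∀ P I : ℝ, -(1 / (n : ℝ)) * Real.logb 2 P - I
      = (-Real.log P - n * Real.log 2 * I) / (n * Real.log 2) := by
    intro P I
    unfold Real.logb
    field_simp
  rw [rw1, abs_div, abs_of_pos (mul_pos hn0 hl2)]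
  have rw2 : (3 * D + 1) * Real.logb 2 n / n = (3 * D + 1) * Real.log n / (n * Real.log 2) := by
    unfold Real.logb
    field_simp
  rw [rw2]
  gcongr
  exact key.trans key2

end Types
end
end

section
/- Disjoint representative subsets (key step in Lemma 4). Let j ≥ 1 and let M_1, …, M_j be finite subsets of a common finite set such that |M_i| ≥ 8·j·ln j for every i ∈ {1,…,j}. Then there exist subsets M_i* ⊆ M_i for i = 1,…,j which are pairwise disjoint (M_i* ∩ M_ℓ* = ∅ for i ≠ ℓ) and satisfy |M_i*| ≥ |M_i|/(2j) for every i. -/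
noncomputable section

/-- **Disjoint representative subsets** (key step in Lemma 4).  If
`|M_i| ≥ 8·j·ln j` for all `i`, then there are pairwise disjoint subsets
`M_i* ⊆ M_i` with `|M_i*| ≥ |M_i|/(2j)`. -/
theorem disjoint_representative_subsets {γ : Type*} [DecidableEq γ]
    (j : ℕ) (hj : 1 ≤ j) (M : Fin j → Finset γ)
    (hM : ∀ i, 8 * (j : ℝ) * Real.log j ≤ ((M i).card : ℝ)) :
    ∃ Ms : Fin j → Finset γ,
      (∀ i, Ms i ⊆ M i) ∧
      (∀ i ℓ, i ≠ ℓ → Disjoint (Ms i) (Ms ℓ)) ∧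
      (∀ i, ((M i).card : ℝ) / (2 * (j : ℝ)) ≤ ((Ms i).card : ℝ)) := by
  have hall := (Finset.all_card_le_biUnion_card_iff_exists_injective
    (fun x : (Σ i : Fin j, Fin ((M i).card / j)) => M x.1)).1 ?_
  · obtain ⟨f, hf, hfM⟩ := hall
    refine ⟨fun i => Finset.univ.image (fun k => f ⟨i, k⟩), ?_, ?_, ?_⟩
    · intro i x hx
      obtain ⟨k, -, rfl⟩ := Finset.mem_image.1 hx
      exact hfM ⟨i, k⟩
    · intro i l hil
      rw [Finset.disjoint_left]
      intro x hx hx2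
      obtain ⟨k, -, rfl⟩ := Finset.mem_image.1 hx
      obtain ⟨k2, -, h⟩ := Finset.mem_image.1 hx2
      have h3 := congrArg Sigma.fst (hf h)
      exact hil h3.symm
    · intro i
      have hc : (Finset.univ.image (fun k => f ⟨i, k⟩)).card = (M i).card / j := by
        rw [Finset.card_image_of_injective, Finset.card_univ, Fintype.card_fin]
        intro a b hab
        have h3 := hf hab
        simpa using h3
      simp only [hc]
      have hj0 : (0 : ℝ) < j := by exact_mod_cast hj
      rw [div_le_iff₀ (by positivity)]
      have key : (M i).card ≤ ((M i).card / j) * (2 * j) := by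
        rcases Nat.eq_or_lt_of_le hj with h1 | h1
        · subst h1
          simp only [Nat.div_one]
          omega
        · have hl : (1 / 2 : ℝ) ≤ Real.log j := by
            have h2 : Real.log 2 ≤ Real.log j :=
              Real.log_le_log (by norm_num) (by exact_mod_cast h1)
            have := Real.log_two_gt_d9
            linarith
          have hm : j ≤ (M i).card := by
            have : (j : ℝ) ≤ ((M i).card : ℝ) := by
              have := hM i
              nlinarith
            exact_mod_cast this
          have h4 := Nat.div_add_mod (M i).card j
          have h5 := Nat.mod_lt (M i).card hj
          have h6 : 1 ≤ (M i).card / j := (Nat.one_le_div_iff hj).2 hm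
          nlinarith
      exact_mod_cast key
  · intro S
    rcases S.eq_empty_or_nonempty with rfl | hS
    · simp
    obtain ⟨x0, hx0, hmax⟩ := Finset.exists_max_image S (fun x => (M x.1).card) hS
    calc S.card ≤ ((Finset.univ : Finset (Fin j)) ×ˢ
          Finset.range ((M x0.1).card / j)).card := by
          apply Finset.card_le_card_of_injOn (fun x => (x.1, x.2.val))
          · intro x hx
            have h1 : (M x.1).card / j ≤ (M x0.1).card / j :=
              Nat.div_le_div_right (hmax x hx)
            have h2 := x.2.isLt
            simp only [Finset.coe_product, Set.mem_prod, Finset.mem_coe, Finset.mem_univ,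
              Finset.mem_range, true_and]
            omega
          · rintro ⟨a, b⟩ - ⟨c, d⟩ - h
            simp only [Prod.mk.injEq] at h
            obtain ⟨rfl, h⟩ := h
            rw [Fin.ext h]
      _ = j * ((M x0.1).card / j) := by simp
      _ ≤ (M x0.1).card := Nat.mul_div_le _ _
      _ ≤ _ := Finset.card_le_card (Finset.subset_biUnion_of_mem (fun x => M x.1) hx0)
end
end

section
/- Fourier–Motzkin projection identity underlying Theorem 3. Let j ≥ 1 be a real number and let A, B, C be real numbers with B ≥ 0 and C ≥ 0. Suppose nonnegative reals r, α, κ satisfy: r + α ≤ A; (1 + 1/j)·α − κ ≤ B; (1 + 1/j)·α − κ ≤ C; and α ≤ j·κ. Then there exist nonnegative reals r̂, α̂, κ̂ and β ≥ 0 such that: r̂ + α̂ ≤ A; α̂ ≤ B; α̂ ≤ C; α̂ ≤ j·κ̂; r ≤ r̂ − β; α ≤ α̂ + β; and κ ≥ κ̂ + (1 + 1/j)·β. -/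
/-- **Fourier–Motzkin projection identity underlying Theorem 3.**  If the
nonnegative reals `(r, α, κ)` satisfy the combined-region inequalities with
constants `A`, `B ≥ 0`, `C ≥ 0` and `j ≥ 1`, then there exist nonnegative
`r̂, α̂, κ̂` and `β ≥ 0` realizing them as a Theorem 1 point shifted by the
Theorem 2 rate transfer. -/
theorem fourier_motzkin_projection
    (j A B C r α κ : ℝ) (hj : 1 ≤ j) (hB : 0 ≤ B) (hC : 0 ≤ C)
    (hr : 0 ≤ r) (hα : 0 ≤ α) (hκ : 0 ≤ κ)
    (h1 : r + α ≤ A)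
    (h2 : (1 + 1 / j) * α - κ ≤ B)
    (h3 : (1 + 1 / j) * α - κ ≤ C)
    (h4 : α ≤ j * κ) :
    ∃ rh αh κh β : ℝ,
      0 ≤ rh ∧ 0 ≤ αh ∧ 0 ≤ κh ∧ 0 ≤ β ∧
      rh + αh ≤ A ∧ αh ≤ B ∧ αh ≤ C ∧ αh ≤ j * κh ∧
      r ≤ rh - β ∧ α ≤ αh + β ∧ κh + (1 + 1 / j) * β ≤ κ := by
  have hj0 : 0 < j := by linarith
  have ht : 0 ≤ 1 / j := by positivity
  have hjt : j * (1 / j) = 1 := by field_simp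
  have h5 : 1 / j * α ≤ κ := by
    calc 1 / j * α ≤ 1 / j * (j * κ) := mul_le_mul_of_nonneg_left h4 ht
      _ = κ := by field_simp
  generalize 1 / j = t at *
  obtain ⟨a, ha⟩ : ∃ a, a = max 0 ((1 + t) * α - κ) := ⟨_, rfl⟩
  have ha0 : 0 ≤ a := ha ▸ le_max_left _ _
  have ha1 : (1 + t) * α - κ ≤ a := ha ▸ le_max_right _ _
  have haB : a ≤ B := ha ▸ max_le hB h2
  have haC : a ≤ C := ha ▸ max_le hC h3
  have haα : a ≤ α := ha ▸ max_le hα (by linarith)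
  refine ⟨r + (α - a), a, t * a, α - a, by linarith, ha0, mul_nonneg ht ha0, by linarith,
    by linarith, haB, haC, ?_, by linarith, by linarith, by linarith⟩
  rw [← mul_assoc, hjt, one_mul]
end
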